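/- arXiv:0805.1614 — 5 statements merged into one kernel-verified Lean document; each statement's English description precedes it below -/
import Mathlib

section
/- Let n ≥ 1 and let U_n ⊂ U_{n+1} ⊂ C^{n+1}([a,b]) possess non-negative Bernstein bases p_{n,k} (k = 0,...,n) and p_{n+1,k} (k = 0,...,n+1). Let (f_0,f_1) be a Haar pair in U_n, let B_n be a Bernstein operator fixing f_0, f_1 with strictly increasing nodes t_{n,k} and coefficients α_{n,k}, and let B_{n+1} be the Bernstein operator fixing f_0, f_1 on U_{n+1} with nodes t_{n+1,k} and coefficients α_{n+1,k} (which exists and has strictly interlacing nodes). For k = 1,...,n define G_k(f) = f(t_{n,k}) α_{n,k} · p_{n,k}^{(k)}(a)/p_{n+1,k}^{(k)}(a) − f(t_{n+1,k}) α_{n+1,k} + f(t_{n,k−1}) α_{n,k−1} · p_{n,k−1}^{(n+1−k)}(b)/p_{n+1,k}^{(n+1−k)}(b). Then B_n f − B_{n+1} f = Σ_{k=1}^n G_k(f) · p_{n+1,k} for every f ∈ C[a,b]; in particular, if f is (f_0,f_1)-convex then B_n f ≥ B_{n+1} f on [a,b]. -/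
open Finset

def IsBernsteinBasisOf (n : ℕ) (a b : ℝ) (U : Submodule ℝ (ℝ → ℝ)) (p : ℕ → ℝ → ℝ) : Prop :=
  (∀ k ≤ n, p k ∈ U) ∧
  (∀ k ≤ n, ContDiff ℝ n (p k)) ∧
  (∀ k ≤ n,
    (∀ i < k, iteratedDeriv i (p k) a = 0) ∧ iteratedDeriv k (p k) a ≠ 0 ∧
    (∀ i < n - k, iteratedDeriv i (p k) b = 0) ∧ iteratedDeriv (n - k) (p k) b ≠ 0)

def IsNonnegBernsteinBasisOf (n : ℕ) (a b : ℝ) (U : Submodule ℝ (ℝ → ℝ)) (p : ℕ → ℝ → ℝ) : Prop :=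
  IsBernsteinBasisOf n a b U p ∧ ∀ k ≤ n, ∀ x ∈ Set.Icc a b, 0 ≤ p k x

def IsHaarPair (a b : ℝ) (f0 f1 : ℝ → ℝ) : Prop :=
  ContinuousOn f0 (Set.Icc a b) ∧ ContinuousOn f1 (Set.Icc a b) ∧
  (∀ x ∈ Set.Icc a b, 0 < f0 x) ∧
  StrictMonoOn (fun x => f1 x / f0 x) (Set.Icc a b)

noncomputable def bernOp (n : ℕ) (p : ℕ → ℝ → ℝ) (t : ℕ → ℝ) (α : ℕ → ℝ) (f : ℝ → ℝ) : ℝ → ℝ :=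
  fun x => ∑ k ∈ Finset.range (n + 1), f (t k) * α k * p k x

def FixesOn (a b : ℝ) (B : (ℝ → ℝ) → ℝ → ℝ) (f : ℝ → ℝ) : Prop :=
  ∀ x ∈ Set.Icc a b, B f x = f x

def ConvexWrt (a b : ℝ) (f0 f1 f : ℝ → ℝ) : Prop :=
  ∀ x0 ∈ Set.Icc a b, ∀ x1 ∈ Set.Icc a b, ∀ x2 ∈ Set.Icc a b, x0 < x1 → x1 < x2 →
    0 ≤ Matrix.det !![f0 x0, f0 x1, f0 x2; f1 x0, f1 x1, f1 x2; f x0, f x1, f x2]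

def IsExtChebyshev (m : ℕ) (a b : ℝ) (U : Submodule ℝ (ℝ → ℝ)) : Prop :=
  Module.finrank ℝ U = m + 1 ∧
  (∀ f ∈ U, ContDiff ℝ m f) ∧
  (∀ f ∈ U, f ≠ 0 → ∀ (S : Finset ℝ) (μ : ℝ → ℕ),
    (∀ x ∈ S, x ∈ Set.Icc a b) →
    (∀ x ∈ S, ∀ i < μ x, iteratedDeriv i f x = 0) →
    ∑ x ∈ S, μ x ≤ m)

theorem iteratedDeriv_sum_mul {N : ℕ} {r : ℕ → ℝ → ℝ} (hr : ∀ j ≤ N, ContDiff ℝ N (r j))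
    (c : ℕ → ℝ) {i : ℕ} (hi : i ≤ N) (x : ℝ) :
    iteratedDeriv i (fun y => ∑ j ∈ range (N + 1), c j * r j y) x =
      ∑ j ∈ range (N + 1), c j * iteratedDeriv i (r j) x := by
  have hd : ∀ j ∈ range (N + 1), ContDiffAt ℝ i (r j) x := fun j hj =>
    ((hr j (Nat.lt_succ_iff.1 (mem_range.1 hj))).of_le (by exact_mod_cast hi)).contDiffAt
  rw [iteratedDeriv_fun_sum fun j hj => contDiffAt_const.mul (hd j hj)]
  exact sum_congr rfl fun j hj => iteratedDeriv_const_mul _ (hd j hj)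

/-- If `r j` vanishes to exact order `j` at `x`, a combination of the `r j` vanishing to order `k`
at `x` involves only indices `≥ k`, and its `k`-th derivative is that of the `k`-th term. -/
theorem leading_coeff_of_vanishing {N : ℕ} {r : ℕ → ℝ → ℝ} (hr : ∀ j ≤ N, ContDiff ℝ N (r j))
    {x : ℝ} (hr0 : ∀ j ≤ N, ∀ i < j, iteratedDeriv i (r j) x = 0)
    (hr1 : ∀ j ≤ N, iteratedDeriv j (r j) x ≠ 0) {c : ℕ → ℝ} {k : ℕ} (hk : k ≤ N)
    (hg : ∀ i < k, iteratedDeriv i (fun y => ∑ j ∈ range (N + 1), c j * r j y) x = 0) :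
    (∀ j < k, c j = 0) ∧
      iteratedDeriv k (fun y => ∑ j ∈ range (N + 1), c j * r j y) x =
        c k * iteratedDeriv k (r k) x := by
  have key : ∀ m ≤ N, (∀ j < m, c j = 0) →
      iteratedDeriv m (fun y => ∑ j ∈ range (N + 1), c j * r j y) x =
        c m * iteratedDeriv m (r m) x := by
    intro m hm hc
    rw [iteratedDeriv_sum_mul hr c hm]
    refine sum_eq_single m (fun j hj hne => ?_) (fun h => absurd (mem_range.2 (by omega)) h)
    rcases lt_or_gt_of_ne hne with h | h
    · rw [hc j h, zero_mul]
    · rw [hr0 j (Nat.lt_succ_iff.1 (mem_range.1 hj)) m h, mul_zero]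
  have hc : ∀ j < k, c j = 0 := by
    intro j
    induction j using Nat.strong_induction_on with
    | _ j ih =>
      intro hj
      have h := key j (by omega) fun i hi => ih i hi (by omega)
      rw [hg j hj] at h
      exact (mul_eq_zero.1 h.symm).resolve_right (hr1 j (by omega))
  exact ⟨hc, key k hk hc⟩

theorem iteratedDeriv_eq_zero_of_eqOn_Icc {N : ℕ} {g : ℝ → ℝ} (hg : ContDiff ℝ N g) {a b : ℝ}
    (hab : a < b) (h0 : ∀ x ∈ Set.Icc a b, g x = 0) {i : ℕ} (hi : i ≤ N) :
    iteratedDeriv i g a = 0 := by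
  have hE : Set.EqOn (iteratedDeriv i g) (fun _ => 0) (Set.Ioo a b) := by
    intro x hx
    have h : g =ᶠ[nhds x] fun _ => 0 := by
      filter_upwards [Ioo_mem_nhds hx.1 hx.2] with y hy
      exact h0 y (Set.Ioo_subset_Icc_self hy)
    rw [h.iteratedDeriv_eq]
    exact iteratedDeriv_fun_const_zero
  have := hE.closure (hg.continuous_iteratedDeriv i (by exact_mod_cast hi)) continuous_const
  rw [closure_Ioo hab.ne] at this
  exact this (Set.left_mem_Icc.2 hab.le)

namespace IsBernsteinBasisOf

variable {N : ℕ} {a b : ℝ} {U : Submodule ℝ (ℝ → ℝ)} {q : ℕ → ℝ → ℝ}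

theorem leading_coeff_left (hq : IsBernsteinBasisOf N a b U q) {c : ℕ → ℝ} {k : ℕ} (hk : k ≤ N)
    (hg : ∀ i < k, iteratedDeriv i (fun y => ∑ j ∈ range (N + 1), c j * q j y) a = 0) :
    (∀ j < k, c j = 0) ∧
      iteratedDeriv k (fun y => ∑ j ∈ range (N + 1), c j * q j y) a =
        c k * iteratedDeriv k (q k) a :=
  leading_coeff_of_vanishing hq.2.1 (fun j hj => (hq.2.2 j hj).1)
    (fun j hj => (hq.2.2 j hj).2.1) hk hg

theorem leading_coeff_right (hq : IsBernsteinBasisOf N a b U q) {c : ℕ → ℝ} {k : ℕ} (hk : k ≤ N)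
    (hg : ∀ i < N - k, iteratedDeriv i (fun y => ∑ j ∈ range (N + 1), c j * q j y) b = 0) :
    (∀ j ≤ N, k < j → c j = 0) ∧
      iteratedDeriv (N - k) (fun y => ∑ j ∈ range (N + 1), c j * q j y) b =
        c k * iteratedDeriv (N - k) (q k) b := by
  have hs : (fun y => ∑ j ∈ range (N + 1), c j * q j y) =
      fun y => ∑ j ∈ range (N + 1), c (N - j) * q (N - j) y := by
    funext y
    exact (sum_range_reflect (fun j => c j * q j y) (N + 1)).symm
  rw [hs] at hg ⊢
  have h := leading_coeff_of_vanishing (N := N) (r := fun j => q (N - j)) (x := b)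
    (c := fun j => c (N - j)) (fun j _ => hq.2.1 _ (Nat.sub_le N j))
    (fun j hj i hi => (hq.2.2 (N - j) (Nat.sub_le N j)).2.2.1 i (by omega))
    (fun j hj => by
      have := (hq.2.2 (N - j) (Nat.sub_le N j)).2.2.2
      rwa [Nat.sub_sub_self hj] at this)
    (Nat.sub_le N k) hg
  refine ⟨fun j hj hkj => ?_, ?_⟩
  · have := h.1 (N - j) (by omega)
    simpa only [Nat.sub_sub_self hj] using this
  · simpa only [Nat.sub_sub_self hk] using h.2

theorem coeff_eq_zero (hq : IsBernsteinBasisOf N a b U q) (hab : a < b) {c : ℕ → ℝ}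
    (h0 : ∀ x ∈ Set.Icc a b, ∑ j ∈ range (N + 1), c j * q j x = 0) {j : ℕ} (hj : j ≤ N) :
    c j = 0 := by
  have hd : ContDiff ℝ N (fun y => ∑ j ∈ range (N + 1), c j * q j y) :=
    ContDiff.sum fun j hj =>
      contDiff_const.mul (hq.2.1 j (Nat.lt_succ_iff.1 (mem_range.1 hj)))
  have hz : ∀ i ≤ N, iteratedDeriv i (fun y => ∑ j ∈ range (N + 1), c j * q j y) a = 0 :=
    fun i hi => iteratedDeriv_eq_zero_of_eqOn_Icc hd hab h0 hi
  have h := (hq.leading_coeff_left hj fun i hi => hz i (by omega)).2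
  rw [hz j hj] at h
  exact (mul_eq_zero.1 h.symm).resolve_right (hq.2.2 j hj).2.1

theorem exists_coeff (hq : IsBernsteinBasisOf N a b U q) (hab : a < b)
    (hdim : Module.finrank ℝ U = N + 1) {g : ℝ → ℝ} (hg : g ∈ U) :
    ∃ c : ℕ → ℝ, g = fun x => ∑ j ∈ range (N + 1), c j * q j x := by
  have hli : LinearIndependent ℝ (fun i : Fin (N + 1) => q i) := by
    rw [Fintype.linearIndependent_iff]
    intro c hc i
    have := hq.coeff_eq_zero hab (c := fun j => if h : j < N + 1 then c ⟨j, h⟩ else 0)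
      (fun x _ => by
        rw [sum_range]
        simpa only [Fin.is_lt, dite_true, Fin.eta, Finset.sum_apply, Pi.smul_apply, smul_eq_mul,
          Pi.zero_apply] using congrFun hc x) (Nat.lt_succ_iff.1 i.2)
    simpa only [Fin.is_lt, dite_true, Fin.eta] using this
  have : FiniteDimensional ℝ U := Module.finite_of_finrank_pos (by omega)
  have hspan : Submodule.span ℝ (Set.range fun i : Fin (N + 1) => q i) = U := by
    apply Submodule.eq_of_le_of_finrank_eq
    · rw [Submodule.span_le]
      rintro _ ⟨i, rfl⟩
      exact hq.1 i (Nat.lt_succ_iff.1 i.2)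
    · rw [finrank_span_eq_card hli, hdim, Fintype.card_fin]
  rw [← hspan, Submodule.mem_span_range_iff_exists_fun] at hg
  obtain ⟨c, rfl⟩ := hg
  refine ⟨fun j => if h : j < N + 1 then c ⟨j, h⟩ else 0, ?_⟩
  funext x
  rw [sum_range]
  simp only [Fin.is_lt, dite_true, Fin.eta, Finset.sum_apply, Pi.smul_apply, smul_eq_mul]

/-- Degree elevation: each `p k` is a combination of `q k` and `q (k + 1)`. -/
theorem degree_elevation {n : ℕ} {V : Submodule ℝ (ℝ → ℝ)} {p : ℕ → ℝ → ℝ} (hab : a < b)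
    (hUV : U ≤ V) (hdim : Module.finrank ℝ V = n + 2) (hp : IsBernsteinBasisOf n a b U p)
    (hq : IsBernsteinBasisOf (n + 1) a b V q) {k : ℕ} (hk : k ≤ n) (x : ℝ) :
    p k x = iteratedDeriv k (p k) a / iteratedDeriv k (q k) a * q k x +
      iteratedDeriv (n - k) (p k) b / iteratedDeriv (n - k) (q (k + 1)) b * q (k + 1) x := by
  obtain ⟨c, hc⟩ := hq.exists_coeff hab hdim (hUV (hp.1 k hk))
  obtain ⟨hl0, hl1⟩ := hq.leading_coeff_left (c := c) (k := k) (by omega)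
    (by rw [← hc]; exact (hp.2.2 k hk).1)
  obtain ⟨hr0, hr1⟩ := hq.leading_coeff_right (c := c) (k := k + 1) (by omega)
    (by rw [← hc, Nat.add_sub_add_right]; exact (hp.2.2 k hk).2.2.1)
  rw [← hc] at hl1 hr1
  rw [Nat.add_sub_add_right] at hr1
  have hb := (hq.2.2 (k + 1) (by omega)).2.2.2
  rw [Nat.add_sub_add_right] at hb
  rw [hl1, hr1, mul_div_cancel_right₀ _ (hq.2.2 k (by omega)).2.1, mul_div_cancel_right₀ _ hb,
    congrFun hc x]
  refine sum_eq_add k (k + 1) (by omega) (fun j hj hne => ?_)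
    (fun h => absurd (mem_range.2 (by omega)) h) (fun h => absurd (mem_range.2 (by omega)) h)
  have hj' := mem_range.1 hj
  rcases lt_or_ge j k with h | h
  · rw [hl0 j h, zero_mul]
  · rw [hr0 j (by omega) (by have := hne.1; have := hne.2; omega), zero_mul]

end IsBernsteinBasisOf

theorem IsHaarPair.minor_pos {a b : ℝ} {f0 f1 : ℝ → ℝ} (h : IsHaarPair a b f0 f1) {x y : ℝ}
    (hx : x ∈ Set.Icc a b) (hy : y ∈ Set.Icc a b) (hxy : x < y) :
    0 < f0 x * f1 y - f0 y * f1 x := by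
  have := h.2.2.2 hx hy hxy
  simp only [div_lt_div_iff₀ (h.2.2.1 x hx) (h.2.2.1 y hy)] at this
  linarith

/-- A three-point functional annihilating a Haar pair, with negative middle weight, is non-negative
on convex functions. -/
theorem ConvexWrt.three_point_nonneg {a b : ℝ} {f0 f1 f : ℝ → ℝ} (hf : ConvexWrt a b f0 f1 f)
    (hH : IsHaarPair a b f0 f1) {x y z : ℝ} (hx : x ∈ Set.Icc a b) (hy : y ∈ Set.Icc a b)
    (hz : z ∈ Set.Icc a b) (hxy : x < y) (hyz : y < z) {u v w : ℝ} (hv : 0 < v)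
    (h0 : w * f0 z - v * f0 y + u * f0 x = 0) (h1 : w * f1 z - v * f1 y + u * f1 x = 0) :
    0 ≤ w * f z - v * f y + u * f x := by
  have hD := hH.minor_pos hx hz (hxy.trans hyz)
  have hdet := hf x hx y hy z hz hxy hyz
  have hdet' : Matrix.det !![f0 x, f0 y, f0 z; f1 x, f1 y, f1 z; f x, f y, f z] =
      f x * (f0 y * f1 z - f0 z * f1 y) - f y * (f0 x * f1 z - f0 z * f1 x) +
        f z * (f0 x * f1 y - f0 y * f1 x) := by
    simp [Matrix.det_fin_three]
    ring
  rw [hdet'] at hdet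
  have hu : u * (f0 x * f1 z - f0 z * f1 x) = v * (f0 y * f1 z - f0 z * f1 y) := by
    linear_combination f1 z * h0 - f0 z * h1
  have hw : w * (f0 x * f1 z - f0 z * f1 x) = v * (f0 x * f1 y - f0 y * f1 x) := by
    linear_combination f0 x * h1 - f1 x * h0
  refine nonneg_of_mul_nonneg_left ?_ hD
  have := mul_nonneg hv.le hdet
  calc _ ≤ _ := this
    _ = _ := by linear_combination - f z * hw - f x * hu

/-- Aramă-type formula
`B_n f − B_{n+1} f = Σ_{k=1}^n G_k(f) p_{n+1,k}`, and monotonicity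
`B_{n+1} f ≤ B_n f` for (f0,f1)-convex f. -/
theorem bernstein_difference_formula
    (n : ℕ) (hn : 1 ≤ n) (a b : ℝ) (hab : a < b)
    (Un Un1 : Submodule ℝ (ℝ → ℝ)) (hsub : Un ≤ Un1)
    (hdimn : Module.finrank ℝ Un = n + 1)
    (hdimn1 : Module.finrank ℝ Un1 = n + 2)
    (hsmooth : ∀ f ∈ Un1, ContDiff ℝ (n + 1) f)
    (p : ℕ → ℝ → ℝ) (hp : IsNonnegBernsteinBasisOf n a b Un p)
    (q : ℕ → ℝ → ℝ) (hq : IsNonnegBernsteinBasisOf (n + 1) a b Un1 q)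
    (f0 f1 : ℝ → ℝ) (hf0U : f0 ∈ Un) (hf1U : f1 ∈ Un)
    (hHaar : IsHaarPair a b f0 f1)
    -- the Bernstein operator at level n, with strictly increasing nodes
    (t : ℕ → ℝ) (α : ℕ → ℝ)
    (ht : ∀ k ≤ n, t k ∈ Set.Icc a b)
    (hα : ∀ k ≤ n, 0 < α k)
    (hfix0 : FixesOn a b (bernOp n p t α) f0)
    (hfix1 : FixesOn a b (bernOp n p t α) f1)
    (ht0 : t 0 = a) (htn : t n = b)
    (htmono : ∀ k < n, t k < t (k + 1))
    -- the Bernstein operator at level n+1, with strictly interlacing nodes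
    (t' : ℕ → ℝ) (α' : ℕ → ℝ)
    (ht' : ∀ k ≤ n + 1, t' k ∈ Set.Icc a b)
    (hα' : ∀ k ≤ n + 1, 0 < α' k)
    (hfix0' : FixesOn a b (bernOp (n + 1) q t' α') f0)
    (hfix1' : FixesOn a b (bernOp (n + 1) q t' α') f1)
    (ht0' : t' 0 = a) (htn' : t' (n + 1) = b)
    (hinter : ∀ k, 1 ≤ k → k ≤ n → t (k - 1) < t' k ∧ t' k < t k) :
    (∀ f : ℝ → ℝ, ContinuousOn f (Set.Icc a b) → ∀ x ∈ Set.Icc a b,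
      bernOp n p t α f x - bernOp (n + 1) q t' α' f x =
        ∑ k ∈ Finset.Icc 1 n,
          (f (t k) * α k * (iteratedDeriv k (p k) a / iteratedDeriv k (q k) a)
            - f (t' k) * α' k
            + f (t (k - 1)) * α (k - 1) *
              (iteratedDeriv (n + 1 - k) (p (k - 1)) b / iteratedDeriv (n + 1 - k) (q k) b))
          * q k x) ∧
    (∀ f : ℝ → ℝ, ContinuousOn f (Set.Icc a b) → ConvexWrt a b f0 f1 f →
      ∀ x ∈ Set.Icc a b, bernOp (n + 1) q t' α' f x ≤ bernOp n p t α f x) := by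
  have hdiff : ∀ f : ℝ → ℝ, ∀ x, bernOp n p t α f x - bernOp (n + 1) q t' α' f x =
      ∑ k ∈ range (n + 2),
        ((if k ≤ n then
            f (t k) * α k * (iteratedDeriv k (p k) a / iteratedDeriv k (q k) a) else 0)
          - f (t' k) * α' k
          + (if 1 ≤ k then f (t (k - 1)) * α (k - 1) *
            (iteratedDeriv (n + 1 - k) (p (k - 1)) b / iteratedDeriv (n + 1 - k) (q k) b) else 0))
        * q k x := by
    intro f x
    simp only [add_mul, sub_mul, sum_add_distrib, sum_sub_distrib]
    have hB : bernOp n p t α f x =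
        ∑ k ∈ range (n + 1), f (t k) * α k *
            (iteratedDeriv k (p k) a / iteratedDeriv k (q k) a) * q k x +
          ∑ k ∈ range (n + 1), f (t k) * α k *
            (iteratedDeriv (n - k) (p k) b / iteratedDeriv (n - k) (q (k + 1)) b) *
              q (k + 1) x := by
      rw [← sum_add_distrib]
      refine sum_congr rfl fun k hk => ?_
      rw [IsBernsteinBasisOf.degree_elevation hab hsub hdimn1 hp.1 hq.1
        (Nat.lt_succ_iff.1 (mem_range.1 hk)) x]
      ring
    have hL : ∑ k ∈ range (n + 2), (if k ≤ n then
          f (t k) * α k * (iteratedDeriv k (p k) a / iteratedDeriv k (q k) a) else 0) * q k x =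
        ∑ k ∈ range (n + 1), f (t k) * α k *
            (iteratedDeriv k (p k) a / iteratedDeriv k (q k) a) * q k x := by
      rw [sum_range_succ, if_neg (by omega), zero_mul, add_zero]
      exact sum_congr rfl fun k hk => by rw [if_pos (Nat.lt_succ_iff.1 (mem_range.1 hk))]
    have hR : ∑ k ∈ range (n + 2), (if 1 ≤ k then f (t (k - 1)) * α (k - 1) *
            (iteratedDeriv (n + 1 - k) (p (k - 1)) b / iteratedDeriv (n + 1 - k) (q k) b) else 0)
              * q k x =
        ∑ k ∈ range (n + 1), f (t k) * α k *
            (iteratedDeriv (n - k) (p k) b / iteratedDeriv (n - k) (q (k + 1)) b) *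
              q (k + 1) x := by
      rw [sum_range_succ', if_neg (by omega), zero_mul, add_zero]
      refine sum_congr rfl fun k _ => ?_
      rw [if_pos (by omega), Nat.add_sub_cancel, Nat.add_sub_add_right]
    rw [hB, hL, hR, bernOp]
    ring
  have hzero : ∀ g : ℝ → ℝ, FixesOn a b (bernOp n p t α) g →
      FixesOn a b (bernOp (n + 1) q t' α') g → ∀ k ≤ n + 1,
      ((if k ≤ n then
            g (t k) * α k * (iteratedDeriv k (p k) a / iteratedDeriv k (q k) a) else 0)
          - g (t' k) * α' k
          + (if 1 ≤ k then g (t (k - 1)) * α (k - 1) *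
            (iteratedDeriv (n + 1 - k) (p (k - 1)) b / iteratedDeriv (n + 1 - k) (q k) b)
              else 0)) = 0 := by
    intro g hg hg' k hk
    refine hq.1.coeff_eq_zero hab (c := fun k => ((if k ≤ n then
            g (t k) * α k * (iteratedDeriv k (p k) a / iteratedDeriv k (q k) a) else 0)
          - g (t' k) * α' k
          + (if 1 ≤ k then g (t (k - 1)) * α (k - 1) *
            (iteratedDeriv (n + 1 - k) (p (k - 1)) b / iteratedDeriv (n + 1 - k) (q k) b)
              else 0))) (fun x hx => ?_) hk
    rw [← hdiff, hg x hx, hg' x hx, sub_self]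
  have hz0 := hzero f0 hfix0 hfix0'
  have hz1 := hzero f1 hfix1 hfix1'
  have hfa : f0 a ≠ 0 := (hHaar.2.2.1 a (Set.left_mem_Icc.2 hab.le)).ne'
  have hfb : f0 b ≠ 0 := (hHaar.2.2.1 b (Set.right_mem_Icc.2 hab.le)).ne'
  have hformula : ∀ f : ℝ → ℝ, ∀ x, bernOp n p t α f x - bernOp (n + 1) q t' α' f x =
        ∑ k ∈ Finset.Icc 1 n,
          (f (t k) * α k * (iteratedDeriv k (p k) a / iteratedDeriv k (q k) a)
            - f (t' k) * α' k
            + f (t (k - 1)) * α (k - 1) *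
              (iteratedDeriv (n + 1 - k) (p (k - 1)) b / iteratedDeriv (n + 1 - k) (q k) b))
          * q k x := by
    intro f x
    have hleft := hz0 0 (by omega)
    have hright := hz0 (n + 1) le_rfl
    rw [if_pos (by omega), if_neg (by omega), ht0, ht0'] at hleft
    rw [if_neg (by omega), if_pos (by omega), Nat.add_sub_cancel, htn, htn'] at hright
    have hleft' : α 0 * (iteratedDeriv 0 (p 0) a / iteratedDeriv 0 (q 0) a) - α' 0 = 0 :=
      (mul_eq_zero.1 (by linear_combination hleft :
        f0 a * (α 0 * (iteratedDeriv 0 (p 0) a / iteratedDeriv 0 (q 0) a) - α' 0) = 0)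
        ).resolve_left hfa
    have hright' : α n * (iteratedDeriv (n + 1 - (n + 1)) (p n) b /
        iteratedDeriv (n + 1 - (n + 1)) (q (n + 1)) b) - α' (n + 1) = 0 :=
      (mul_eq_zero.1 (by linear_combination hright :
        f0 b * (α n * (iteratedDeriv (n + 1 - (n + 1)) (p n) b /
          iteratedDeriv (n + 1 - (n + 1)) (q (n + 1)) b) - α' (n + 1)) = 0)).resolve_left hfb
    rw [hdiff]
    symm
    refine sum_subset_zero_on_sdiff (fun k hk => ?_) (fun k hk => ?_) (fun k hk => ?_)
    · have := mem_Icc.1 hk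
      exact mem_range.2 (by omega)
    · simp only [mem_sdiff, mem_range, mem_Icc, not_and, not_le] at hk
      have : k = 0 ∨ k = n + 1 := by omega
      rcases this with rfl | rfl
      · rw [if_pos (by omega), if_neg (by omega), ht0, ht0']
        linear_combination f a * q 0 x * hleft'
      · rw [if_neg (by omega), if_pos (by omega), Nat.add_sub_cancel, htn, htn']
        linear_combination f b * q (n + 1) x * hright'
    · have := mem_Icc.1 hk
      rw [if_pos this.2, if_pos this.1]
  refine ⟨fun f _ x _ => hformula f x, fun f _ hconv x hx => ?_⟩
  rw [← sub_nonneg, hformula]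
  refine sum_nonneg fun k hk => ?_
  obtain ⟨hk1, hkn⟩ := mem_Icc.1 hk
  refine mul_nonneg ?_ (hq.2 k (by omega) x hx)
  have h0 := hz0 k (by omega)
  have h1 := hz1 k (by omega)
  rw [if_pos hkn, if_pos hk1] at h0 h1
  have := hconv.three_point_nonneg hHaar (ht (k - 1) (by omega)) (ht' k (by omega)) (ht k hkn)
    (hinter k hk1 hkn).1 (hinter k hk1 hkn).2 (hα' k (by omega))
    (u := α (k - 1) *
      (iteratedDeriv (n + 1 - k) (p (k - 1)) b / iteratedDeriv (n + 1 - k) (q k) b))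
    (w := α k * (iteratedDeriv k (p k) a / iteratedDeriv k (q k) a))
    (by linear_combination h0) (by linear_combination h1)
  linear_combination this
end

section
/- Let U_n be an extended Chebyshev space of dimension n+1 over [a,b], let (f_0, f_1) be a Haar pair with f_0, f_1 ∈ U_n, and assume there exists a Bernstein operator B_n : C[a,b] → U_n fixing f_0 and f_1 whose nodes are increasing: t_{n,0} ≤ t_{n,1} ≤ ... ≤ t_{n,n}. Then for every continuous (f_0,f_1)-convex function f on [a,b], the function B_n f is (f_0,f_1)-convex. -/
open Finset

open Filter Topology

/-- If all order-preserving minors of `M` and `N` are non-negative, so is `det (M * N)`. -/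
lemma Matrix.det_mul_nonneg_of_minors {r : ℕ} {ι : Type*} [Fintype ι] [LinearOrder ι]
    (M : Matrix (Fin r) ι ℝ) (N : Matrix ι (Fin r) ℝ)
    (hM : ∀ q : Fin r → ι, StrictMono q → 0 ≤ (M.submatrix id q).det)
    (hN : ∀ q : Fin r → ι, StrictMono q → 0 ≤ (N.submatrix q id).det) :
    0 ≤ (M * N).det := by
  have hexp : (M * N).det =
      ∑ q : Fin r → ι, (∏ j, N (q j) j) * (M.submatrix id q).det := by
    simp only [Matrix.det_apply', Matrix.mul_apply, Finset.prod_univ_sum, Finset.mul_sum,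
      Fintype.piFinset_univ, Matrix.submatrix_apply, id]
    rw [Finset.sum_comm]
    refine Finset.sum_congr rfl fun q _ => Finset.sum_congr rfl fun σ _ => ?_
    rw [Finset.prod_mul_distrib]
    ring
  have hperm : ∀ σ : Equiv.Perm (Fin r), (M * N).det =
      ∑ q : Fin r → ι, (Equiv.Perm.sign σ * ∏ j, N (q (σ j)) j) * (M.submatrix id q).det := by
    intro σ
    rw [hexp, ← (Equiv.arrowCongr σ (Equiv.refl ι)).symm.sum_comp]
    refine Finset.sum_congr rfl fun q _ => ?_
    have : M.submatrix id ((Equiv.arrowCongr σ (Equiv.refl ι)).symm q)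
        = (M.submatrix id q).submatrix id σ := by
      ext i j
      simp [Equiv.arrowCongr]
    rw [this, Matrix.det_permute']
    simp [Equiv.arrowCongr]
    ring
  have hsum : (Fintype.card (Equiv.Perm (Fin r)) : ℝ) * (M * N).det =
      ∑ q : Fin r → ι, (N.submatrix q id).det * (M.submatrix id q).det := by
    calc (Fintype.card (Equiv.Perm (Fin r)) : ℝ) * (M * N).det
        = ∑ _σ : Equiv.Perm (Fin r), (M * N).det := by simp
      _ = ∑ σ : Equiv.Perm (Fin r), ∑ q : Fin r → ι,
            (Equiv.Perm.sign σ * ∏ j, N (q (σ j)) j) * (M.submatrix id q).det :=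
          Finset.sum_congr rfl fun σ _ => hperm σ
      _ = _ := by
          rw [Finset.sum_comm]
          refine Finset.sum_congr rfl fun q _ => ?_
          rw [← Finset.sum_mul, Matrix.det_apply' (N.submatrix q id)]
          rfl
  have hcard : (0 : ℝ) < Fintype.card (Equiv.Perm (Fin r)) := by
    exact_mod_cast Fintype.card_pos
  refine nonneg_of_mul_nonneg_right (hsum ▸ Finset.sum_nonneg fun q _ => ?_) hcard
  by_cases hq : Function.Injective q
  · have hmono : StrictMono (q ∘ Tuple.sort q) :=
      (Tuple.monotone_sort q).strictMono_of_injective (hq.comp (Tuple.sort q).injective)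
    have h1 := hM _ hmono
    have h2 := hN _ hmono
    have e1 : M.submatrix id (q ∘ Tuple.sort q)
        = (M.submatrix id q).submatrix id (Tuple.sort q) := rfl
    have e2 : N.submatrix (q ∘ Tuple.sort q) id
        = (N.submatrix q id).submatrix (Tuple.sort q) id := rfl
    rw [e1, Matrix.det_permute'] at h1
    rw [e2, Matrix.det_permute] at h2
    have h3 := mul_nonneg h2 h1
    rcases Int.units_eq_one_or (Equiv.Perm.sign (Tuple.sort q)) with h | h <;>
      simpa [h] using h3
  · obtain ⟨i, j, hij, hne⟩ : ∃ i j, q i = q j ∧ i ≠ j := by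
      simpa [Function.Injective] using hq
    rw [Matrix.det_zero_of_column_eq (M := M.submatrix id q) hne (fun k => by simp [hij]),
      mul_zero]

lemma tendsto_div_pow_of_iteratedDeriv_eq_zero {g : ℝ → ℝ} {a : ℝ} {k : ℕ}
    (hg : ContDiff ℝ k g) (h : ∀ i < k, iteratedDeriv i g a = 0) :
    Tendsto (fun x => g x / (x - a) ^ k) (𝓝[>] a)
      (𝓝 ((k.factorial : ℝ)⁻¹ * iteratedDeriv k g a)) := by
  have h1 := Real.taylor_tendsto (n := k) convex_univ (Set.mem_univ a) hg.contDiffOn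
  have h2 := (h1.mono_left (nhdsWithin_mono a (Set.subset_univ (Set.Ioi a)))).add_const
    ((k.factorial : ℝ)⁻¹ * iteratedDeriv k g a)
  rw [zero_add] at h2
  refine h2.congr' ?_
  filter_upwards [self_mem_nhdsWithin] with x hx
  have hx' : (x - a) ^ k ≠ 0 := pow_ne_zero _ (sub_ne_zero.2 (ne_of_gt hx))
  rw [taylor_within_apply, Finset.sum_range_succ, Finset.sum_eq_zero]
  · simp only [iteratedDerivWithin_univ, smul_eq_mul]
    field_simp
    ring
  · intro i hi
    rw [iteratedDerivWithin_univ, h i (Finset.mem_range.1 hi), smul_zero]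

lemma pos_on_Ioo_of_ne_zero_of_tendsto {g : ℝ → ℝ} {a c L : ℝ}
    (hg : ContinuousOn g (Set.Ioo a c)) (hne : ∀ x ∈ Set.Ioo a c, g x ≠ 0)
    (hL : 0 < L) (hlim : Tendsto g (𝓝[>] a) (𝓝 L)) :
    ∀ x ∈ Set.Ioo a c, 0 < g x := by
  intro x hx
  by_contra hneg
  have hac : a < c := hx.1.trans hx.2
  obtain ⟨y, hy, hyI⟩ :=
    ((hlim.eventually (lt_mem_nhds hL)).and (Ioo_mem_nhdsGT hac)).exists
  obtain ⟨z, hz, hz0⟩ := isPreconnected_Ioo.intermediate_value hx hyI hg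
    (show (0 : ℝ) ∈ Set.Icc (g x) (g y) from ⟨not_lt.1 hneg, hy.le⟩)
  exact hne z hz hz0

section BernsteinBasis

variable {n : ℕ} {a b : ℝ} {U : Submodule ℝ (ℝ → ℝ)} {p : ℕ → ℝ → ℝ}

lemma iteratedDeriv_sum_mul_bernstein (hp : IsBernsteinBasisOf n a b U p) {k r : ℕ}
    (hk : k + r ≤ n + 1) (c : Fin r → ℝ) {i : ℕ} (hi : i ≤ n) (x : ℝ) :
    iteratedDeriv i (∑ l : Fin r, c l • p (k + l)) x
      = ∑ l : Fin r, c l * iteratedDeriv i (p (k + l)) x := by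
  have hs : ∀ l : Fin r, ContDiff ℝ i (p (k + l)) := fun l =>
    (hp.2.1 (k + l) (by omega)).of_le (by exact_mod_cast hi)
  have hgen : ∀ s : Finset (Fin r), iteratedDeriv i (∑ l ∈ s, c l • p (k + l)) x
      = ∑ l ∈ s, c l * iteratedDeriv i (p (k + l)) x := by
    intro s
    induction s using Finset.induction_on with
    | empty => simp [iteratedDeriv_eq_iteratedFDeriv]
    | insert l s hl ih =>
      have h1 : ContDiff ℝ i (∑ l ∈ s, c l • p (k + l)) := by
        have : ContDiff ℝ i (fun y => ∑ l ∈ s, c l • p (k + l) y) :=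
          ContDiff.sum fun l _ => (hs l).const_smul (c l)
        convert this using 1
        ext y
        simp
      rw [Finset.sum_insert hl, Finset.sum_insert hl,
        iteratedDeriv_add (f := c l • p (k + l)) (contDiff_const.smul (hs l)).contDiffAt
          h1.contDiffAt, ih]
      simp
  exact hgen _

lemma coeff_eq_zero_of_bernstein_sum_eq_zero (hp : IsBernsteinBasisOf n a b U p) {k r : ℕ}
    (hk : k + r ≤ n + 1) (c : Fin r → ℝ) (h : ∑ l : Fin r, c l • p (k + l) = 0) : c = 0 := by
  have key : ∀ m : ℕ, ∀ l : Fin r, l.1 = m → c l = 0 := by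
    intro m
    induction m using Nat.strong_induction_on with
    | _ m ih =>
      rintro l rfl
      have h1 := iteratedDeriv_sum_mul_bernstein hp hk c (i := k + l) (by omega) a
      rw [h, Finset.sum_eq_single l] at h1
      · have h0 : iteratedDeriv (k + l) (0 : ℝ → ℝ) a = 0 := by
          simp [iteratedDeriv_eq_iteratedFDeriv]
        rw [h0] at h1
        exact (mul_eq_zero.1 h1.symm).resolve_right (hp.2.2 (k + l) (by omega)).2.1
      · intro l' _ hne
        rcases lt_or_gt_of_ne (fun e => hne (Fin.ext e) : l'.1 ≠ l.1) with hlt | hgt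
        · rw [ih l' hlt l' rfl, zero_mul]
        · rw [(hp.2.2 (k + l') (by omega)).1 (k + l) (by omega), mul_zero]
      · simp
  exact funext fun l => key l l rfl

lemma det_bernstein_ne_zero (hab : a < b) (hU : IsExtChebyshev n a b U)
    (hp : IsBernsteinBasisOf n a b U p) {k r : ℕ} (hk : k + r ≤ n + 1) {x : Fin r → ℝ}
    (hx : ∀ j, x j ∈ Set.Ioo a b) (hinj : Function.Injective x) :
    (Matrix.of fun i j : Fin r => p (k + i) (x j)).det ≠ 0 := by
  intro hdet
  obtain ⟨c, hc, hcx⟩ := Matrix.exists_vecMul_eq_zero_iff.2 hdet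
  set h : ℝ → ℝ := ∑ l : Fin r, c l • p (k + l) with hh
  have hhx : ∀ j, h (x j) = 0 := by
    intro j
    have := congrFun hcx j
    simpa [hh, Matrix.vecMul, dotProduct] using this
  have hhU : h ∈ U := U.sum_mem fun l _ => U.smul_mem _ (hp.1 _ (by omega))
  have hne : h ≠ 0 := fun h0 => hc (coeff_eq_zero_of_bernstein_sum_eq_zero hp hk c h0)
  have haI : a ∉ insert b (Finset.univ.image x) := by
    simp only [Finset.mem_insert, Finset.mem_image, Finset.mem_univ, true_and, not_or,
      not_exists]
    exact ⟨hab.ne, fun j => (hx j).1.ne'⟩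
  have hbI : b ∉ Finset.univ.image x := by
    simp only [Finset.mem_image, Finset.mem_univ, true_and, not_exists]
    exact fun j => (hx j).2.ne
  have hcount := hU.2.2 h hhU hne (insert a (insert b (Finset.univ.image x)))
    (fun y => if y = a then k else if y = b then n + 1 - (k + r) else 1) ?_ ?_
  · rw [Finset.sum_insert haI, Finset.sum_insert hbI, Finset.sum_image hinj.injOn] at hcount
    simp [hab.ne', fun j => (hx j).1.ne', fun j => (hx j).2.ne] at hcount
    omega
  · intro y hy
    simp only [Finset.mem_insert, Finset.mem_image, Finset.mem_univ, true_and] at hy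
    rcases hy with rfl | rfl | ⟨j, rfl⟩
    · exact Set.left_mem_Icc.2 hab.le
    · exact Set.right_mem_Icc.2 hab.le
    · exact Set.Ioo_subset_Icc_self (hx j)
  · intro y hy i hi
    simp only [Finset.mem_insert, Finset.mem_image, Finset.mem_univ, true_and] at hy
    rcases hy with rfl | rfl | ⟨j, rfl⟩
    · rw [if_pos rfl] at hi
      rcases Nat.eq_zero_or_pos r with rfl | hr
      · exact absurd (Subsingleton.elim c 0) hc
      rw [iteratedDeriv_sum_mul_bernstein hp hk c (by omega)]
      refine Finset.sum_eq_zero fun l _ => ?_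
      rw [(hp.2.2 (k + l) (by omega)).1 i (by omega), mul_zero]
    · rw [if_neg hab.ne', if_pos rfl] at hi
      rw [iteratedDeriv_sum_mul_bernstein hp hk c (by omega)]
      refine Finset.sum_eq_zero fun l _ => ?_
      rw [(hp.2.2 (k + l) (by omega)).2.2.1 i (by omega), mul_zero]
    · rw [if_neg (hx j).1.ne', if_neg (hx j).2.ne] at hi
      obtain rfl : i = 0 := by omega
      simpa using hhx j

lemma bernstein_pos (hab : a < b) (hU : IsExtChebyshev n a b U)
    (hp : IsNonnegBernsteinBasisOf n a b U p) {k : ℕ} (hk : k ≤ n) {x : ℝ}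
    (hx : x ∈ Set.Ioo a b) : 0 < p k x := by
  have h := det_bernstein_ne_zero hab hU hp.1 (k := k) (r := 1) (by omega) (x := fun _ => x)
    (fun _ => hx) (fun _ _ _ => Subsingleton.elim _ _)
  rw [Matrix.det_fin_one] at h
  exact lt_of_le_of_ne (hp.2 k hk x (Set.Ioo_subset_Icc_self hx)) (by simpa using h.symm)

lemma tendsto_bernstein_div (hp : IsBernsteinBasisOf n a b U p) {i j : ℕ} (hij : i < j)
    (hj : j ≤ n) : Tendsto (fun x => p j x / p i x) (𝓝[>] a) (𝓝 0) := by
  have h1 := tendsto_div_pow_of_iteratedDeriv_eq_zero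
    ((hp.2.1 j hj).of_le (by exact_mod_cast (by omega : i ≤ n)))
    (fun m hm => (hp.2.2 j hj).1 m (hm.trans hij))
  have h2 := tendsto_div_pow_of_iteratedDeriv_eq_zero
    ((hp.2.1 i (by omega)).of_le (by exact_mod_cast (by omega : i ≤ n)))
    (fun m hm => (hp.2.2 i (by omega)).1 m hm)
  rw [(hp.2.2 j hj).1 i hij, mul_zero] at h1
  have h3 := h1.div h2 (mul_ne_zero (by positivity) (hp.2.2 i (by omega)).2.1)
  rw [zero_div] at h3
  refine h3.congr' ?_
  filter_upwards [self_mem_nhdsWithin] with x hx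
  exact div_div_div_cancel_right₀ (pow_ne_zero _ (sub_ne_zero.2 (ne_of_gt hx))) _ _

lemma continuous_bernstein (hp : IsBernsteinBasisOf n a b U p) {k : ℕ} (hk : k ≤ n) :
    Continuous (p k) := (hp.2.1 k hk).continuous

/-- Consecutive minors of order two of the collocation matrix are positive. -/
lemma bernstein_minor_two_succ_pos (hab : a < b) (hU : IsExtChebyshev n a b U)
    (hp : IsNonnegBernsteinBasisOf n a b U p) {k : ℕ} (hk : k + 1 ≤ n) {x y : ℝ}
    (hx : x ∈ Set.Ioo a b) (hy : y ∈ Set.Ioo a b) (hxy : x < y) :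
    0 < p k x * p (k + 1) y - p k y * p (k + 1) x := by
  have hpos : ∀ z ∈ Set.Ioo a y, 0 < p k z := fun z hz =>
    bernstein_pos hab hU hp (by omega) ⟨hz.1, hz.2.trans hy.2⟩
  have key := pos_on_Ioo_of_ne_zero_of_tendsto (a := a) (c := y)
    (g := fun z => p (k + 1) y - p k y * (p (k + 1) z / p k z)) ?_ ?_
    (bernstein_pos hab hU hp hk hy) ?_ x ⟨hx.1, hxy⟩
  · have h := mul_pos (hpos x ⟨hx.1, hxy⟩) key
    have hne := (hpos x ⟨hx.1, hxy⟩).ne'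
    field_simp at h
    linarith
  · exact continuousOn_const.sub (continuousOn_const.mul
      ((continuous_bernstein hp.1 hk).continuousOn.div
        (continuous_bernstein hp.1 (by omega)).continuousOn fun z hz => (hpos z hz).ne'))
  · intro z hz h0
    have hne := (hpos z hz).ne'
    refine det_bernstein_ne_zero hab hU hp.1 (k := k) (r := 2) (by omega) (x := ![z, y]) ?_ ?_ ?_
    · intro j
      fin_cases j
      · exact ⟨hz.1, hz.2.trans hy.2⟩
      · exact hy
    · intro i j hij
      fin_cases i <;> fin_cases j <;> simp_all [hz.2.ne, hz.2.ne']
    · rw [Matrix.det_fin_two]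
      field_simp at h0
      simp
      linarith
  · simpa using ((tendsto_bernstein_div hp.1 (Nat.lt_succ_self k) hk).const_mul
      (p k y)).const_sub (p (k + 1) y)

lemma bernstein_minor_two_pos (hab : a < b) (hU : IsExtChebyshev n a b U)
    (hp : IsNonnegBernsteinBasisOf n a b U p) {i j : ℕ} (hij : i < j) (hj : j ≤ n) {x y : ℝ}
    (hx : x ∈ Set.Ioo a b) (hy : y ∈ Set.Ioo a b) (hxy : x < y) :
    0 < p i x * p j y - p i y * p j x := by
  induction j, hij using Nat.le_induction with
  | base => exact bernstein_minor_two_succ_pos hab hU hp hj hx hy hxy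
  | succ j hij ih =>
    have h1 := ih (by omega)
    have h2 := bernstein_minor_two_succ_pos hab hU hp hj hx hy hxy
    have hi := bernstein_pos hab hU hp (by omega : i ≤ n) hx
    have hjx := bernstein_pos hab hU hp (by omega : j ≤ n) hx
    have hj1 := bernstein_pos hab hU hp hj hx
    refine pos_of_mul_pos_right (a := p j x) ?_ hjx.le
    linear_combination mul_pos hi h2 + mul_pos hj1 h1

/-- Consecutive minors of order three of the collocation matrix are positive. -/
lemma bernstein_minor_three_succ_pos (hab : a < b) (hU : IsExtChebyshev n a b U)
    (hp : IsNonnegBernsteinBasisOf n a b U p) {k : ℕ} (hk : k + 2 ≤ n) {x y z : ℝ}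
    (hx : x ∈ Set.Ioo a b) (hy : y ∈ Set.Ioo a b) (hz : z ∈ Set.Ioo a b)
    (hxy : x < y) (hyz : y < z) :
    0 < Matrix.det !![p k x, p k y, p k z; p (k + 1) x, p (k + 1) y, p (k + 1) z;
      p (k + 2) x, p (k + 2) y, p (k + 2) z] := by
  have hpos : ∀ w ∈ Set.Ioo a y, 0 < p k w := fun w hw =>
    bernstein_pos hab hU hp (by omega) ⟨hw.1, hw.2.trans hy.2⟩
  have key := pos_on_Ioo_of_ne_zero_of_tendsto (a := a) (c := y)
    (g := fun w => (p (k + 1) y * p (k + 2) z - p (k + 1) z * p (k + 2) y)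
      - (p (k + 1) w / p k w) * (p k y * p (k + 2) z - p k z * p (k + 2) y)
      + (p (k + 2) w / p k w) * (p k y * p (k + 1) z - p k z * p (k + 1) y)) ?_ ?_
    (bernstein_minor_two_succ_pos hab hU hp hk hy hz hyz) ?_ x ⟨hx.1, hxy⟩
  · have h := mul_pos (hpos x ⟨hx.1, hxy⟩) key
    have hne := (hpos x ⟨hx.1, hxy⟩).ne'
    field_simp at h
    simp [Matrix.det_fin_three]
    linarith
  · have hc : ∀ m ≤ n, ContinuousOn (fun w => p m w / p k w) (Set.Ioo a y) := fun m hm =>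
      (continuous_bernstein hp.1 hm).continuousOn.div
        (continuous_bernstein hp.1 (by omega)).continuousOn fun w hw => (hpos w hw).ne'
    exact (continuousOn_const.sub ((hc _ (by omega)).mul continuousOn_const)).add
      ((hc _ hk).mul continuousOn_const)
  · intro w hw h0
    have hne := (hpos w hw).ne'
    have hwz := hw.2.trans hyz
    refine det_bernstein_ne_zero hab hU hp.1 (k := k) (r := 3) (by omega)
      (x := ![w, y, z]) ?_ ?_ ?_
    · intro j
      fin_cases j
      · exact ⟨hw.1, hw.2.trans hy.2⟩
      · exact hy
      · exact hz
    · intro i j hij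
      fin_cases i <;> fin_cases j <;>
        simp_all [hw.2.ne, hw.2.ne', hyz.ne, hyz.ne', hwz.ne, hwz.ne']
    · rw [Matrix.det_fin_three]
      field_simp at h0
      simp
      linarith
  · simpa using (((tendsto_bernstein_div hp.1 (by omega : k < k + 1) (by omega)).mul_const
      (p k y * p (k + 2) z - p k z * p (k + 2) y)).const_sub
        (p (k + 1) y * p (k + 2) z - p (k + 1) z * p (k + 2) y)).add
      ((tendsto_bernstein_div hp.1 (by omega : k < k + 2) hk).mul_const
        (p k y * p (k + 1) z - p k z * p (k + 1) y))

/-- All minors of order three of the collocation matrix on the open interval are positive. -/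
lemma bernstein_minor_three_pos (hab : a < b) (hU : IsExtChebyshev n a b U)
    (hp : IsNonnegBernsteinBasisOf n a b U p) {i j k : ℕ} (hij : i < j) (hjk : j < k)
    (hk : k ≤ n) {x y z : ℝ}
    (hx : x ∈ Set.Ioo a b) (hy : y ∈ Set.Ioo a b) (hz : z ∈ Set.Ioo a b)
    (hxy : x < y) (hyz : y < z) :
    0 < Matrix.det !![p i x, p i y, p i z; p j x, p j y, p j z; p k x, p k y, p k z] := by
  have h2 : ∀ l m, l < m → m ≤ n → 0 < p l x * p m y - p l y * p m x := fun l m hlm hm =>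
    bernstein_minor_two_pos hab hU hp hlm hm hx hy hxy
  obtain ⟨d, hd⟩ : ∃ d, k - i = d := ⟨_, rfl⟩
  induction d using Nat.strong_induction_on generalizing i j k with
  | _ d ih =>
    by_cases h1 : j + 1 < k
    · have e1 := ih (j + 1 - i) (by omega) hij (Nat.lt_succ_self j) (by omega) rfl
      have e2 := ih (k - j) (by omega) (Nat.lt_succ_self j) h1 hk rfl
      refine pos_of_mul_pos_right (a := p j x * p (j + 1) y - p j y * p (j + 1) x) ?_
        (h2 j (j + 1) (Nat.lt_succ_self j) (by omega)).le
      have e3 := add_pos (mul_pos e1 (h2 j k hjk hk)) (mul_pos (h2 i j hij (by omega)) e2)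
      simp [Matrix.det_fin_three] at e3 ⊢
      linear_combination e3
    by_cases h3 : i + 1 < j
    · have e1 := ih (j - i) (by omega) (Nat.lt_succ_self i) h3 (by omega) rfl
      have e2 := ih (k - (i + 1)) (by omega) h3 hjk hk rfl
      refine pos_of_mul_pos_right (a := p (i + 1) x * p j y - p (i + 1) y * p j x) ?_
        (h2 (i + 1) j h3 (by omega)).le
      have e3 := add_pos (mul_pos e1 (h2 j k hjk hk)) (mul_pos (h2 i j hij (by omega)) e2)
      simp [Matrix.det_fin_three] at e3 ⊢
      linear_combination e3
    obtain rfl : j = i + 1 := by omega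
    obtain rfl : k = i + 2 := by omega
    exact bernstein_minor_three_succ_pos hab hU hp hk hx hy hz hxy hyz

end BernsteinBasis

lemma convexWrt_of_Ioo {a b : ℝ} (hab : a < b) {f0 f1 g : ℝ → ℝ} (h0 : Continuous f0)
    (h1 : Continuous f1) (hg : Continuous g)
    (h : ∀ x ∈ Set.Ioo a b, ∀ y ∈ Set.Ioo a b, ∀ z ∈ Set.Ioo a b, x < y → y < z →
      0 ≤ Matrix.det !![f0 x, f0 y, f0 z; f1 x, f1 y, f1 z; g x, g y, g z]) :
    ConvexWrt a b f0 f1 g := by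
  intro x hx y hy z hz hxy hyz
  set φ : ℝ → ℝ → ℝ := fun s u => u + s * ((a + b) / 2 - u) with hφ
  have hcont : Continuous fun s => Matrix.det !![f0 (φ s x), f0 (φ s y), f0 (φ s z);
      f1 (φ s x), f1 (φ s y), f1 (φ s z); g (φ s x), g (φ s y), g (φ s z)] := by
    simp only [Matrix.det_fin_three, Matrix.of_apply, Matrix.cons_val, hφ]
    fun_prop
  have hlim := (hcont.tendsto 0).mono_left (nhdsWithin_le_nhds (s := Set.Ioi 0))
  simp only [hφ, zero_mul, add_zero] at hlim
  refine ge_of_tendsto hlim ?_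
  filter_upwards [Ioo_mem_nhdsGT (zero_lt_one (α := ℝ))] with s hs
  have hmem : ∀ u ∈ Set.Icc a b, u + s * ((a + b) / 2 - u) ∈ Set.Ioo a b := by
    intro u hu
    constructor <;> nlinarith [hs.1, hs.2, hu.1, hu.2]
  have hlt : ∀ u v, u < v → u + s * ((a + b) / 2 - u) < v + s * ((a + b) / 2 - v) := by
    intro u v huv
    nlinarith [hs.2]
  exact h _ (hmem x hx) _ (hmem y hy) _ (hmem z hz) (hlt _ _ hxy) (hlt _ _ hyz)

/-- a Bernstein operator on an extended Chebyshev space with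
increasing nodes preserves (f0,f1)-convexity. -/
theorem bernstein_operator_preserves_convexity
    (n : ℕ) (hn : 1 ≤ n) (a b : ℝ) (hab : a < b)
    (U : Submodule ℝ (ℝ → ℝ)) (hU : IsExtChebyshev n a b U)
    (p : ℕ → ℝ → ℝ) (hp : IsNonnegBernsteinBasisOf n a b U p)
    (f0 f1 : ℝ → ℝ) (hf0U : f0 ∈ U) (hf1U : f1 ∈ U)
    (hHaar : IsHaarPair a b f0 f1)
    (t : ℕ → ℝ) (α : ℕ → ℝ)
    (ht : ∀ k ≤ n, t k ∈ Set.Icc a b)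
    (hα : ∀ k ≤ n, 0 < α k)
    (htmono : ∀ k < n, t k ≤ t (k + 1))
    (hfix0 : FixesOn a b (bernOp n p t α) f0)
    (hfix1 : FixesOn a b (bernOp n p t α) f1)
    (f : ℝ → ℝ) (hf : ContinuousOn f (Set.Icc a b))
    (hconv : ConvexWrt a b f0 f1 f) :
    ConvexWrt a b f0 f1 (bernOp n p t α f) := by
  have hcont : Continuous (bernOp n p t α f) := continuous_finsetSum _ fun k hk =>
    continuous_const.mul (continuous_bernstein hp.1 (by simpa [Nat.lt_succ_iff] using hk))
  have htle : ∀ i j, i ≤ j → j ≤ n → t i ≤ t j := by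
    intro i j hij
    induction j, hij using Nat.le_induction with
    | base => exact fun _ => le_rfl
    | succ j _ ih => exact fun hj => (ih (by omega)).trans (htmono j (by omega))
  refine convexWrt_of_Ioo hab (hU.2.1 f0 hf0U).continuous (hU.2.1 f1 hf1U).continuous hcont ?_
  intro x hx y hy z hz hxy hyz
  let F : Fin 3 → ℝ → ℝ := ![f0, f1, f]
  let X : Fin 3 → ℝ := ![x, y, z]
  let M : Matrix (Fin 3) (Fin (n + 1)) ℝ := Matrix.of fun r k => F r (t k) * α k
  let N : Matrix (Fin (n + 1)) (Fin 3) ℝ := Matrix.of fun k j => p k (X j)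
  have hMN : M * N = Matrix.of fun r j => bernOp n p t α (F r) (X j) := by
    ext r j
    simp [M, N, Matrix.mul_apply, bernOp, Finset.sum_range]
  have hpoint : !![f0 x, f0 y, f0 z; f1 x, f1 y, f1 z;
      bernOp n p t α f x, bernOp n p t α f y, bernOp n p t α f z] = M * N := by
    rw [hMN, ← hfix0 x (Set.Ioo_subset_Icc_self hx), ← hfix0 y (Set.Ioo_subset_Icc_self hy),
      ← hfix0 z (Set.Ioo_subset_Icc_self hz), ← hfix1 x (Set.Ioo_subset_Icc_self hx),
      ← hfix1 y (Set.Ioo_subset_Icc_self hy), ← hfix1 z (Set.Ioo_subset_Icc_self hz)]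
    ext r j
    fin_cases r <;> fin_cases j <;> rfl
  rw [hpoint]
  refine Matrix.det_mul_nonneg_of_minors M N (fun q hq => ?_) (fun q hq => ?_)
  · have hq01 : (q 0 : ℕ) < q 1 := hq (by decide : (0 : Fin 3) < 1)
    have hq12 : (q 1 : ℕ) < q 2 := hq (by decide : (1 : Fin 3) < 2)
    have hqn : ∀ i, (q i : ℕ) ≤ n := fun i => Nat.lt_succ_iff.1 (q i).2
    have hdet : (M.submatrix id q).det = (∏ j, α (q j)) *
        Matrix.det !![f0 (t (q 0)), f0 (t (q 1)), f0 (t (q 2));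
          f1 (t (q 0)), f1 (t (q 1)), f1 (t (q 2));
          f (t (q 0)), f (t (q 1)), f (t (q 2))] := by
      rw [← Matrix.det_mul_row]
      congr 1
      ext r j
      fin_cases r <;> fin_cases j <;> exact mul_comm _ _
    rw [hdet]
    refine mul_nonneg (Finset.prod_nonneg fun j _ => (hα _ (hqn j)).le) ?_
    rcases (htle _ _ hq01.le (hqn 1)).eq_or_lt with h01 | h01
    · refine (Matrix.det_zero_of_column_eq (by decide : (0 : Fin 3) ≠ 1) fun r => ?_).ge
      fin_cases r <;> simp [h01]
    rcases (htle _ _ hq12.le (hqn 2)).eq_or_lt with h12 | h12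
    · refine (Matrix.det_zero_of_column_eq (by decide : (1 : Fin 3) ≠ 2) fun r => ?_).ge
      fin_cases r <;> simp [h12]
    exact hconv _ (ht _ (hqn 0)) _ (ht _ (hqn 1)) _ (ht _ (hqn 2)) h01 h12
  · have hpos := bernstein_minor_three_pos hab hU hp
      (hq (by decide : (0 : Fin 3) < 1)) (hq (by decide : (1 : Fin 3) < 2))
      (Nat.lt_succ_iff.1 (q 2).2) hx hy hz hxy hyz
    refine hpos.le.trans_eq (congrArg Matrix.det ?_)
    ext r j
    fin_cases r <;> fin_cases j <;> rfl
end

section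
/- Let U_n be an extended Chebyshev space of dimension n+1 over [a,b], let (f_0, f_1) be a Haar pair with f_0, f_1 ∈ U_n, and assume there exists a Bernstein operator B_n : C[a,b] → U_n fixing f_0 and f_1 with increasing nodes t_{n,0} ≤ ... ≤ t_{n,n}. Let g be a strictly positive function in the span of f_0 and f_1. If f ∈ C[a,b] is g-increasing (i.e. f/g is increasing on [a,b]), then B_n f is g-increasing; likewise if f is g-decreasing then B_n f is g-decreasing. -/
open Finset

/-- A smooth function whose first nonvanishing derivative at `a` is negative is negative
just to the right of `a`. -/
theorem eventually_neg_right_of_iteratedDeriv_neg {k : ℕ} {a : ℝ} {h : ℝ → ℝ}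
    (hc : ContDiff ℝ k h) (h0 : ∀ i < k, iteratedDeriv i h a = 0)
    (hk : iteratedDeriv k h a < 0) : ∀ᶠ x in nhdsWithin a (Set.Ioi a), h x < 0 := by
  induction k generalizing h with
  | zero =>
    rw [iteratedDeriv_zero] at hk
    exact (hc.continuous.continuousAt.eventually_lt continuousAt_const hk).filter_mono
      nhdsWithin_le_nhds
  | succ k ih =>
    have hc' : ContDiff ℝ (k + 1) h := by exact_mod_cast hc
    have hd := ih (contDiff_succ_iff_deriv.1 hc').2.2
      (fun i hi => by rw [← iteratedDeriv_succ']; exact h0 (i + 1) (by omega))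
      (by rwa [← iteratedDeriv_succ'])
    have ha : h a = 0 := by simpa using h0 0 k.succ_pos
    obtain ⟨c, hac, hdc⟩ := mem_nhdsGT_iff_exists_Ioo_subset.1 hd
    filter_upwards [Ioo_mem_nhdsGT hac] with x hx
    have hanti : StrictAntiOn h (Set.Icc a x) := by
      refine strictAntiOn_of_deriv_neg (convex_Icc a x) hc.continuous.continuousOn fun y hy => ?_
      rw [interior_Icc] at hy
      exact hdc ⟨hy.1, hy.2.trans hx.2⟩
    rw [← ha]
    exact hanti (Set.left_mem_Icc.2 hx.1.le) (Set.right_mem_Icc.2 hx.1.le) hx.1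

/-- Counting zeros at both endpoints and at a set of interior points. -/
theorem IsExtChebyshev.card_add_le {m : ℕ} {a b : ℝ} {U : Submodule ℝ (ℝ → ℝ)}
    (hU : IsExtChebyshev m a b U) (hab : a < b) {f : ℝ → ℝ} (hfU : f ∈ U) (hf : f ≠ 0) {r s : ℕ}
    (ha : ∀ i < r, iteratedDeriv i f a = 0) (hb : ∀ i < s, iteratedDeriv i f b = 0)
    {S : Finset ℝ} (hS : ∀ x ∈ S, x ∈ Set.Ioo a b ∧ f x = 0) : r + s + S.card ≤ m := by
  have haS : a ∉ S := fun h => lt_irrefl _ (hS a h).1.1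
  have hbS : b ∉ S := fun h => lt_irrefl _ (hS b h).1.2
  have habS : a ∉ insert b S := by simp [hab.ne, haS]
  have key := hU.2.2 f hfU hf (insert a (insert b S))
    (fun x => if x = a then r else if x = b then s else 1)
    (by
      intro x hx
      rcases Finset.mem_insert.1 hx with rfl | hx
      · exact ⟨le_rfl, hab.le⟩
      rcases Finset.mem_insert.1 hx with rfl | hx
      · exact ⟨hab.le, le_rfl⟩
      exact Set.Ioo_subset_Icc_self (hS x hx).1)
    (by
      intro x hx i hi
      rcases Finset.mem_insert.1 hx with rfl | hx
      · exact ha i (by simpa using hi)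
      rcases Finset.mem_insert.1 hx with rfl | hx
      · exact hb i (by simpa [hab.ne'] using hi)
      have hxab := (hS x hx).1
      have : i = 0 := by simpa [hxab.1.ne', hxab.2.ne] using hi
      rw [this, iteratedDeriv_zero]
      exact (hS x hx).2)
  have hsum : ∑ x ∈ S, (if x = a then r else if x = b then s else 1) = S.card := by
    rw [Finset.card_eq_sum_ones]
    refine Finset.sum_congr rfl fun x hx => ?_
    have hxab := (hS x hx).1
    simp [hxab.1.ne', hxab.2.ne]
  rw [Finset.sum_insert habS, Finset.sum_insert hbS, hsum] at key
  simp only [if_true, if_neg hab.ne'] at key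
  omega

section BernsteinBasis

variable {n : ℕ} {a b : ℝ} {U : Submodule ℝ (ℝ → ℝ)} {p : ℕ → ℝ → ℝ}

theorem IsNonnegBernsteinBasisOf.pos (hp : IsNonnegBernsteinBasisOf n a b U p)
    (hU : IsExtChebyshev n a b U) (hab : a < b) {k : ℕ} (hk : k ≤ n) {x : ℝ}
    (hx : x ∈ Set.Ioo a b) : 0 < p k x := by
  obtain ⟨⟨hpU, -, hpz⟩, hnn⟩ := hp
  refine lt_of_le_of_ne (hnn k hk x (Set.Ioo_subset_Icc_self hx)) fun h => ?_
  obtain ⟨h1, h2, h3, -⟩ := hpz k hk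
  have hne : p k ≠ 0 := fun h0 => h2 (by simp [h0])
  have := hU.card_add_le hab (hpU k hk) hne h1 h3 (S := {x})
    (by simpa using And.intro hx h.symm)
  simp at this
  omega

theorem IsNonnegBernsteinBasisOf.iteratedDeriv_left_pos (hp : IsNonnegBernsteinBasisOf n a b U p)
    (hab : a < b) {k : ℕ} (hk : k ≤ n) : 0 < iteratedDeriv k (p k) a := by
  obtain ⟨⟨-, hpc, hpz⟩, hnn⟩ := hp
  obtain ⟨h1, h2, -, -⟩ := hpz k hk
  by_contra! hle
  have hev := eventually_neg_right_of_iteratedDeriv_neg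
    ((hpc k hk).of_le (by exact_mod_cast hk)) h1 (lt_of_le_of_ne hle h2)
  obtain ⟨x, hneg, hx⟩ := (hev.and (Ioo_mem_nhdsGT hab)).exists
  exact (hnn k hk x (Set.Ioo_subset_Icc_self hx)).not_gt hneg

/-- The ratio of consecutive elements of a Bernstein basis is increasing. -/
theorem IsNonnegBernsteinBasisOf.div_succ_le (hp : IsNonnegBernsteinBasisOf n a b U p)
    (hU : IsExtChebyshev n a b U) (hab : a < b) {k : ℕ} (hk : k + 1 ≤ n) {x y : ℝ}
    (hx : x ∈ Set.Ioo a b) (hy : y ∈ Set.Ioo a b) (hxy : x < y) :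
    p (k + 1) x / p k x ≤ p (k + 1) y / p k y := by
  have hk' : k ≤ n := by omega
  have hpos := fun {z : ℝ} (hz : z ∈ Set.Ioo a b) => hp.pos hU hab hk' hz
  have hlead := hp.iteratedDeriv_left_pos hab hk'
  by_contra! hlt
  obtain ⟨c, hcy, hcx⟩ := exists_between hlt
  have hc : 0 < c := (div_pos (hp.pos hU hab hk hy) (hpos hy)).trans hcy
  rw [div_lt_iff₀ (hpos hy)] at hcy
  rw [lt_div_iff₀ (hpos hx)] at hcx
  obtain ⟨⟨hpU, hpc, hpz⟩, -⟩ := hp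
  obtain ⟨ha0, -, hb0, -⟩ := hpz k hk'
  obtain ⟨ha1, -, hb1, -⟩ := hpz (k + 1) hk
  set h : ℝ → ℝ := p (k + 1) - c • p k with hh
  have hhU : h ∈ U := U.sub_mem (hpU _ hk) (U.smul_mem c (hpU _ hk'))
  have hhc : ContDiff ℝ n h := (hpc _ hk).sub ((hpc _ hk').const_smul c)
  have hhd : ∀ i ≤ n, ∀ z, iteratedDeriv i h z =
      iteratedDeriv i (p (k + 1)) z - c * iteratedDeriv i (p k) z := by
    intro i hi z
    have hi' : (i : WithTop ℕ∞) ≤ n := by exact_mod_cast hi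
    have hsm : ContDiff ℝ n (c • p k) := (hpc _ hk').const_smul c
    rw [hh, iteratedDeriv_sub ((hpc _ hk).of_le hi').contDiffAt (hsm.of_le hi').contDiffAt,
      iteratedDeriv_const_smul_field, smul_eq_mul]
  have hha : ∀ i < k, iteratedDeriv i h a = 0 := fun i hi => by
    rw [hhd i (by omega), ha0 i hi, ha1 i (by omega)]; simp
  have hhb : ∀ i < n - (k + 1), iteratedDeriv i h b = 0 := fun i hi => by
    rw [hhd i (by omega), hb0 i (by omega), hb1 i hi]; simp
  have hhk : iteratedDeriv k h a < 0 := by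
    rw [hhd k hk', ha1 k (by omega), zero_sub]
    exact neg_neg_of_pos (mul_pos hc hlead)
  have hne : h ≠ 0 := fun h0 => by simp [h0] at hhk
  obtain ⟨z, hz, hzx⟩ := ((eventually_neg_right_of_iteratedDeriv_neg
    (hhc.of_le (by exact_mod_cast hk')) hha hhk).and (Ioo_mem_nhdsGT hx.1)).exists
  have hhx : 0 < h x := by simpa [hh] using hcx
  have hhy : h y < 0 := by simpa [hh] using hcy
  obtain ⟨u, hu, hu0⟩ := intermediate_value_Ioo hzx.2.le hhc.continuous.continuousOn ⟨hz, hhx⟩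
  obtain ⟨v, hv, hv0⟩ := intermediate_value_Ioo' hxy.le hhc.continuous.continuousOn ⟨hhy, hhx⟩
  have hcard := hU.card_add_le hab hhU hne hha hhb (S := {u, v}) (by
    intro w hw
    rcases Finset.mem_insert.1 hw with rfl | hw
    · exact ⟨⟨hzx.1.trans hu.1, hu.2.trans hx.2⟩, hu0⟩
    · rw [Finset.mem_singleton.1 hw]
      exact ⟨⟨hx.1.trans hv.1, hv.2.trans hy.2⟩, hv0⟩)
  rw [Finset.card_pair (hu.2.trans hv.1).ne] at hcard
  omega

/-- The minors of order two of a nonnegative Bernstein basis are nonnegative. -/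
theorem IsNonnegBernsteinBasisOf.mul_le_mul (hp : IsNonnegBernsteinBasisOf n a b U p)
    (hU : IsExtChebyshev n a b U) (hab : a < b) {k l : ℕ} (hkl : k < l) (hl : l ≤ n) {x y : ℝ}
    (hx : x ∈ Set.Icc a b) (hy : y ∈ Set.Icc a b) (hxy : x ≤ y) :
    p l x * p k y ≤ p k x * p l y := by
  have hrhs : 0 ≤ p k x * p l y := mul_nonneg (hp.2 k (by omega) x hx) (hp.2 l hl y hy)
  rcases hxy.eq_or_lt with rfl | hxy
  · rw [mul_comm]
  rcases hx.1.eq_or_lt with rfl | hax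
  · have : p l a = 0 := by simpa using (hp.1.2.2 l hl).1 0 (by omega)
    simpa [this] using hrhs
  rcases hy.2.eq_or_lt with rfl | hyb
  · have : p k y = 0 := by simpa using (hp.1.2.2 k (by omega)).2.2.1 0 (by omega)
    simpa [this] using hrhs
  have hx' : x ∈ Set.Ioo a b := ⟨hax, hxy.trans hyb⟩
  have hy' : y ∈ Set.Ioo a b := ⟨hax.trans hxy, hyb⟩
  have hdiv : p l x / p l y ≤ p k x / p k y := by
    induction l, hkl.le using Nat.le_induction with
    | base => exact le_rfl
    | succ l hkl' ih =>
      have hstep : p (l + 1) x / p (l + 1) y ≤ p l x / p l y := by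
        have := hp.div_succ_le hU hab hl hx' hy' hxy
        rw [div_le_div_iff₀ (hp.pos hU hab (by omega) hx') (hp.pos hU hab (by omega) hy')] at this
        rw [div_le_div_iff₀ (hp.pos hU hab hl hy') (hp.pos hU hab (by omega) hy')]
        linarith
      rcases hkl'.eq_or_lt with rfl | hlt
      · exact hstep
      · exact hstep.trans (ih hlt (by omega)
          (mul_nonneg (hp.2 k (by omega) x hx) (hp.2 l (by omega) y hy)))
  rwa [div_le_div_iff₀ (hp.pos hU hab hl hy') (hp.pos hU hab (by omega) hy')] at hdiv

end BernsteinBasis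

/-- Averages of an increasing sequence increase with the weights in the likelihood ratio order. -/
theorem sum_mul_mul_sum_le_of_cross {N : ℕ} {F u v : ℕ → ℝ}
    (hF : ∀ k l, k < l → l < N → F k ≤ F l)
    (huv : ∀ k l, k < l → l < N → u l * v k ≤ u k * v l) :
    (∑ k ∈ range N, F k * u k) * ∑ k ∈ range N, v k ≤
      (∑ k ∈ range N, F k * v k) * ∑ k ∈ range N, u k := by
  induction N with
  | zero => simp
  | succ N ih =>
    have ih := ih (fun k l h1 h2 => hF k l h1 (by omega)) (fun k l h1 h2 => huv k l h1 (by omega))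
    have hlast : 0 ≤ ∑ k ∈ range N, (F N - F k) * (u k * v N - u N * v k) :=
      Finset.sum_nonneg fun k hk => by
        have hk := Finset.mem_range.1 hk
        exact mul_nonneg (sub_nonneg.2 (hF k N hk (by omega)))
          (sub_nonneg.2 (huv k N hk (by omega)))
    have hexp : ∑ k ∈ range N, (F N - F k) * (u k * v N - u N * v k) =
        F N * v N * ∑ k ∈ range N, u k - F N * u N * ∑ k ∈ range N, v k
          - v N * ∑ k ∈ range N, F k * u k + u N * ∑ k ∈ range N, F k * v k := by
      simp only [Finset.mul_sum, ← Finset.sum_sub_distrib, ← Finset.sum_add_distrib]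
      exact Finset.sum_congr rfl fun k _ => by ring
    simp only [Finset.sum_range_succ]
    linarith

/-- An operator of Bernstein type with increasing nodes preserves `g`-monotonicity for each
positive function `g` it fixes. -/
theorem bernOp_div_monotoneOn {n : ℕ} {a b : ℝ} (hab : a < b) {U : Submodule ℝ (ℝ → ℝ)}
    (hU : IsExtChebyshev n a b U) {p : ℕ → ℝ → ℝ} (hp : IsNonnegBernsteinBasisOf n a b U p)
    {t α : ℕ → ℝ} (ht : ∀ k ≤ n, t k ∈ Set.Icc a b) (hα : ∀ k ≤ n, 0 < α k)
    (htmono : ∀ k < n, t k ≤ t (k + 1)) {g : ℝ → ℝ} (hg : FixesOn a b (bernOp n p t α) g)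
    (hgpos : ∀ x ∈ Set.Icc a b, 0 < g x) {f : ℝ → ℝ}
    (hf : MonotoneOn (fun x => f x / g x) (Set.Icc a b)) :
    MonotoneOn (fun x => bernOp n p t α f x / g x) (Set.Icc a b) := by
  intro x hx y hy hxy
  have htle : ∀ k l, k ≤ l → l ≤ n → t k ≤ t l := by
    intro k l hkl
    induction l, hkl using Nat.le_induction with
    | base => exact fun _ => le_rfl
    | succ l _ ih => exact fun hl => (ih (by omega)).trans (htmono l (by omega))
  have hw : ∀ k ≤ n, 0 < g (t k) * α k := fun k hk => mul_pos (hgpos _ (ht k hk)) (hα k hk)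
  have hBf : ∀ z, bernOp n p t α f z =
      ∑ k ∈ range (n + 1), f (t k) / g (t k) * (g (t k) * α k * p k z) := by
    intro z
    refine Finset.sum_congr rfl fun k hk => ?_
    have := (hgpos _ (ht k (Finset.mem_range_succ_iff.1 hk))).ne'
    field_simp
  have key := sum_mul_mul_sum_le_of_cross (N := n + 1) (F := fun k => f (t k) / g (t k))
    (u := fun k => g (t k) * α k * p k x) (v := fun k => g (t k) * α k * p k y)
    (fun k l hkl hl => hf (ht k (by omega)) (ht l (by omega)) (htle k l hkl.le (by omega)))
    (fun k l hkl hl => by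
      have h1 := hp.mul_le_mul hU hab hkl (by omega) hx hy hxy
      have h2 := mul_le_mul_of_nonneg_left h1
        (mul_pos (hw k (by omega)) (hw l (by omega))).le
      linarith)
  rw [← hBf, ← hBf] at key
  change bernOp n p t α f x * bernOp n p t α g y ≤
    bernOp n p t α f y * bernOp n p t α g x at key
  rw [hg x hx, hg y hy] at key
  exact (div_le_div_iff₀ (hgpos x hx) (hgpos y hy)).2 key

/-- a Bernstein operator on an extended Chebyshev space with
increasing nodes preserves g-monotonicity for strictly positive g ∈ span{f0,f1}. -/
theorem bernstein_operator_preserves_g_monotone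
    (n : ℕ) (hn : 1 ≤ n) (a b : ℝ) (hab : a < b)
    (U : Submodule ℝ (ℝ → ℝ)) (hU : IsExtChebyshev n a b U)
    (p : ℕ → ℝ → ℝ) (hp : IsNonnegBernsteinBasisOf n a b U p)
    (f0 f1 : ℝ → ℝ) (hf0U : f0 ∈ U) (hf1U : f1 ∈ U)
    (hHaar : IsHaarPair a b f0 f1)
    (t : ℕ → ℝ) (α : ℕ → ℝ)
    (ht : ∀ k ≤ n, t k ∈ Set.Icc a b)
    (hα : ∀ k ≤ n, 0 < α k)
    (htmono : ∀ k < n, t k ≤ t (k + 1))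
    (hfix0 : FixesOn a b (bernOp n p t α) f0)
    (hfix1 : FixesOn a b (bernOp n p t α) f1)
    (g : ℝ → ℝ) (c d : ℝ) (hg : g = fun x => c * f0 x + d * f1 x)
    (hgpos : ∀ x ∈ Set.Icc a b, 0 < g x)
    (f : ℝ → ℝ) (hf : ContinuousOn f (Set.Icc a b)) :
    (MonotoneOn (fun x => f x / g x) (Set.Icc a b) →
      MonotoneOn (fun x => bernOp n p t α f x / g x) (Set.Icc a b)) ∧
    (AntitoneOn (fun x => f x / g x) (Set.Icc a b) →
      AntitoneOn (fun x => bernOp n p t α f x / g x) (Set.Icc a b)) := by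
  have hfix : FixesOn a b (bernOp n p t α) g := by
    intro x hx
    have h0 := hfix0 x hx
    have h1 := hfix1 x hx
    simp only [hg]
    rw [← h0, ← h1]
    simp only [bernOp, Finset.mul_sum, ← Finset.sum_add_distrib]
    exact Finset.sum_congr rfl fun k _ => by ring
  refine ⟨bernOp_div_monotoneOn hab hU hp ht hα htmono hfix hgpos, fun hanti => ?_⟩
  have hneg : MonotoneOn (fun x => (-f) x / g x) (Set.Icc a b) := by
    simpa only [Pi.neg_apply, neg_div] using hanti.neg
  have := (bernOp_div_monotoneOn hab hU hp ht hα htmono hfix hgpos hneg).neg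
  simpa [bernOp, neg_div] using this
end

section
/- Let U_n ⊂ C^n([a,b]) be a symmetric extended Chebyshev space of dimension n+1 over [a,b] (symmetric meaning: f ∈ U_n implies x ↦ f(a+b−x) is in U_n) containing the constant function 1 and the identity function x. Let p_{n,0},...,p_{n,n} be a non-negative Bernstein basis of U_n normalized so that p_{n,k}((a+b)/2) = 1 for all k, and write 1 = Σ_{k=0}^n β_k p_{n,k}. If there exists a Bernstein operator B_n : C[a,b] → U_n fixing 1 and x, with nodes t_{n,0},...,t_{n,n}, then for all k = 0,...,n one has β_k = β_{n−k} and t_{n,k} + t_{n,n−k} = a + b. -/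
open Finset

theorem IsExtChebyshev.eq_zero_of_eqOn_Icc {m : ℕ} {a b : ℝ} {U : Submodule ℝ (ℝ → ℝ)}
    (hU : IsExtChebyshev m a b U) (hab : a < b) {f : ℝ → ℝ} (hf : f ∈ U)
    (hzero : ∀ x ∈ Set.Icc a b, f x = 0) : f = 0 := by
  by_contra hne
  obtain ⟨S, hS, hcard⟩ := (Set.Icc_infinite hab).exists_subset_card_eq (m + 1)
  have h := hU.2.2 f hf hne S (fun _ => 1) (fun x hx => hS hx) (by
    intro x hx i hi
    obtain rfl : i = 0 := by omega
    simpa using hzero x (hS hx))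
  simp [hcard] at h

theorem IsBernsteinBasisOf.comp_reflect {n : ℕ} {a b : ℝ} {U : Submodule ℝ (ℝ → ℝ)}
    {p : ℕ → ℝ → ℝ} (hp : IsBernsteinBasisOf n a b U p)
    (hsym : ∀ f ∈ U, (fun x => f (a + b - x)) ∈ U) :
    IsBernsteinBasisOf n a b U (fun k x => p (n - k) (a + b - x)) := by
  obtain ⟨hmem, hdiff, hder⟩ := hp
  refine ⟨fun k _ => hsym _ (hmem _ (Nat.sub_le n k)), fun k _ =>
    (hdiff _ (Nat.sub_le n k)).comp (contDiff_const.sub contDiff_id), fun k hk => ?_⟩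
  obtain ⟨ha, ha', hb, hb'⟩ := hder (n - k) (Nat.sub_le n k)
  rw [Nat.sub_sub_self hk] at hb hb'
  simp only [iteratedDeriv_comp_const_sub, add_sub_cancel_left, add_sub_cancel_right]
  refine ⟨fun i hi => ?_, ?_, fun i hi => ?_, ?_⟩
  · simp [hb i hi]
  · simpa using hb'
  · simp [ha i hi]
  · simpa using ha'

/-- A Bernstein basis of an extended Chebyshev space is determined by its values at an
interior point. -/
theorem IsExtChebyshev.bernsteinBasis_eq {n : ℕ} {a b c : ℝ} {U : Submodule ℝ (ℝ → ℝ)}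
    (hU : IsExtChebyshev n a b U) (hc : c ∈ Set.Ioo a b) {p q : ℕ → ℝ → ℝ}
    (hp : IsBernsteinBasisOf n a b U p) (hq : IsBernsteinBasisOf n a b U q)
    {k : ℕ} (hk : k ≤ n) (hpq : p k c = q k c) : p k = q k := by
  by_contra hne
  obtain ⟨hac, hcb⟩ := hc
  have hsub : ∀ i ≤ n, ∀ x,
      iteratedDeriv i (p k - q k) x = iteratedDeriv i (p k) x - iteratedDeriv i (q k) x :=
    fun i hi x => iteratedDeriv_sub
      (((hp.2.1 k hk).of_le (by exact_mod_cast hi)).contDiffAt)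
      (((hq.2.1 k hk).of_le (by exact_mod_cast hi)).contDiffAt)
  obtain ⟨hpa, -, hpb, -⟩ := hp.2.2 k hk
  obtain ⟨hqa, -, hqb, -⟩ := hq.2.2 k hk
  have h := hU.2.2 (p k - q k) (U.sub_mem (hp.1 k hk) (hq.1 k hk)) (sub_ne_zero.2 hne)
    {a, c, b} (fun x => if x = a then k else if x = c then 1 else n - k)
    (by
      intro x hx
      simp only [mem_insert, mem_singleton] at hx
      rcases hx with rfl | rfl | rfl <;> constructor <;> linarith)
    (by
      intro x hx i hi
      simp only [mem_insert, mem_singleton] at hx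
      rcases hx with rfl | rfl | rfl
      · rw [if_pos rfl] at hi
        rw [hsub i (by omega), hpa i hi, hqa i hi, sub_zero]
      · rw [if_neg hac.ne', if_pos rfl] at hi
        obtain rfl : i = 0 := by omega
        simp [hpq]
      · rw [if_neg (hac.trans hcb).ne', if_neg hcb.ne'] at hi
        rw [hsub i (by omega), hpb i hi, hqb i hi, sub_zero])
  rw [sum_insert (by simp [hac.ne, (hac.trans hcb).ne]), sum_insert (by simp [hcb.ne]),
    sum_singleton, if_pos rfl, if_neg hac.ne', if_pos rfl, if_neg (hac.trans hcb).ne',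
    if_neg hcb.ne'] at h
  omega

theorem IsExtChebyshev.bernsteinBasis_coeff_eq {n : ℕ} {a b : ℝ} {U : Submodule ℝ (ℝ → ℝ)}
    (hU : IsExtChebyshev n a b U) (hab : a < b) {p : ℕ → ℝ → ℝ}
    (hp : IsBernsteinBasisOf n a b U p) {c d : ℕ → ℝ}
    (hcd : ∀ x ∈ Set.Icc a b,
      ∑ k ∈ range (n + 1), c k * p k x = ∑ k ∈ range (n + 1), d k * p k x) :
    ∀ k ≤ n, c k = d k := by
  have hle : ∀ {k}, k ∈ range (n + 1) → k ≤ n := fun h => Nat.lt_succ_iff.1 (mem_range.1 h)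
  have hzero : (∑ k ∈ range (n + 1), (c k - d k) • p k) = 0 := by
    refine hU.eq_zero_of_eqOn_Icc hab
      (U.sum_mem fun k hk => U.smul_mem _ (hp.1 k (hle hk))) fun x hx => ?_
    simp [sub_mul, hcd x hx]
  intro k
  induction k using Nat.strong_induction_on with
  | _ k ih =>
    intro hk
    have h := congrArg (fun f => iteratedDeriv k f a) hzero
    have hdiff : ∀ j ∈ range (n + 1), ContDiffAt ℝ k (p j) a := fun j hj =>
      ((hp.2.1 j (hle hj)).of_le (by exact_mod_cast hk)).contDiffAt
    rw [iteratedDeriv_sum (f := fun j => (c j - d j) • p j) fun j hj => (hdiff j hj).const_smul (c j - d j),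
      sum_eq_single_of_mem k (mem_range.2 (by omega))] at h
    · rw [iteratedDeriv_const_smul (hdiff k (mem_range.2 (by omega)))] at h
      simpa [iteratedDeriv_const, Pi.zero_def, (hp.2.2 k hk).2.1, sub_eq_zero] using h
    · intro j hj hjk
      rw [iteratedDeriv_const_smul (hdiff j hj)]
      rcases hjk.lt_or_gt with hlt | hgt
      · simp [ih j hlt (hle hj)]
      · simp [(hp.2.2 j (hle hj)).1 k hgt]

/-- symmetry of the coefficients and nodes of a Bernstein operator
fixing 1 and x on a symmetric extended Chebyshev space. -/
theorem bernstein_operator_symmetric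
    (n : ℕ) (hn : 1 ≤ n) (a b : ℝ) (hab : a < b)
    (U : Submodule ℝ (ℝ → ℝ)) (hU : IsExtChebyshev n a b U)
    (hsym : ∀ f ∈ U, (fun x => f (a + b - x)) ∈ U)
    (hone : (fun _ : ℝ => (1 : ℝ)) ∈ U) (hid : (fun x : ℝ => x) ∈ U)
    (p : ℕ → ℝ → ℝ) (hp : IsNonnegBernsteinBasisOf n a b U p)
    (hnorm : ∀ k ≤ n, p k ((a + b) / 2) = 1)
    (β : ℕ → ℝ)
    (hβ : ∀ x ∈ Set.Icc a b, (1 : ℝ) = ∑ k ∈ Finset.range (n + 1), β k * p k x)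
    (t : ℕ → ℝ) (α : ℕ → ℝ)
    (ht : ∀ k ≤ n, t k ∈ Set.Icc a b)
    (hα : ∀ k ≤ n, 0 < α k)
    (hfix0 : FixesOn a b (bernOp n p t α) (fun _ => (1 : ℝ)))
    (hfix1 : FixesOn a b (bernOp n p t α) (fun x => x)) :
    ∀ k ≤ n, β k = β (n - k) ∧ t k + t (n - k) = a + b := by
  have hmid : (a + b) / 2 ∈ Set.Ioo a b := ⟨by linarith, by linarith⟩
  have hrefl : ∀ k ≤ n, ∀ x, p k (a + b - x) = p (n - k) x := fun k hk x => by
    have h := hU.bernsteinBasis_eq hmid hp.1 (hp.1.comp_reflect hsym) (Nat.sub_le n k) (by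
      rw [Nat.sub_sub_self hk, show a + b - (a + b) / 2 = (a + b) / 2 by ring,
        hnorm k hk, hnorm _ (Nat.sub_le n k)])
    simpa [Nat.sub_sub_self hk] using (congrFun h x).symm
  have hmem : ∀ x ∈ Set.Icc a b, a + b - x ∈ Set.Icc a b := fun x hx =>
    ⟨by linarith [hx.2], by linarith [hx.1]⟩
  have hsum : ∀ (c : ℕ → ℝ) (x : ℝ), ∑ k ∈ range (n + 1), c k * p k (a + b - x) =
      ∑ k ∈ range (n + 1), c (n - k) * p k x := fun c x => by
    rw [← sum_range_reflect]
    refine sum_congr rfl fun k hk => ?_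
    have hk : k ≤ n := Nat.lt_succ_iff.1 (mem_range.1 hk)
    rw [show n + 1 - 1 - k = n - k by omega, hrefl _ (Nat.sub_le n k), Nat.sub_sub_self hk]
  have hβsymm : ∀ k ≤ n, β k = β (n - k) :=
    hU.bernsteinBasis_coeff_eq hab hp.1 fun x hx => by
      rw [← hsum, ← hβ x hx, ← hβ _ (hmem x hx)]
  have hαβ : ∀ k ≤ n, α k = β k := hU.bernsteinBasis_coeff_eq hab hp.1 fun x hx => by
    rw [← hβ x hx]
    simpa [bernOp] using hfix0 x hx
  have hnode : ∀ k ≤ n, (a + b) * β k - t k * α k = t (n - k) * α (n - k) :=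
    hU.bernsteinBasis_coeff_eq hab hp.1 fun x hx => by
      have h₁ : ∑ k ∈ range (n + 1), t k * α k * p k x = x := hfix1 x hx
      have h₂ : ∑ k ∈ range (n + 1), t k * α k * p k (a + b - x) = a + b - x :=
        hfix1 _ (hmem x hx)
      rw [← hsum fun k => t k * α k, h₂]
      simp only [sub_mul, mul_assoc (a + b), sum_sub_distrib]
      rw [← mul_sum, ← hβ x hx, h₁, mul_one]
  refine fun k hk => ⟨hβsymm k hk, ?_⟩
  have h := hnode k hk
  rw [hαβ _ (Nat.sub_le n k), ← hβsymm k hk, ← hαβ k hk] at h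
  refine mul_right_cancel₀ (hα k hk).ne' ?_
  linarith
end

section
/- Let ρ_0 ≈ 4.4934 be the first positive root of the equation sin b − b cos b = 0, and let b ∈ (ρ_0, 2π). Let U_3 be the span of 1, x, cos x, sin x on [0,b], and let p_{3,0}, p_{3,1}, p_{3,2}, p_{3,3} be a non-negative Bernstein basis of U_3 over [0,b]. Then there do not exist nodes t_0, t_1, t_2, t_3 ∈ [0,b] and strictly positive coefficients α_0, α_1, α_2, α_3 such that the operator B_3 f = Σ_{k=0}^3 f(t_k) α_k p_{3,k} satisfies B_3 1 = 1 and B_3(x) = x on [0,b]. -/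
open Finset

theorem hasDerivAt_sin_sub_mul_cos (x : ℝ) :
    HasDerivAt (fun x => Real.sin x - x * Real.cos x) (x * Real.sin x) x := by
  refine ((Real.hasDerivAt_sin x).fun_sub
    ((hasDerivAt_id' x).fun_mul (Real.hasDerivAt_cos x))).congr_deriv ?_
  ring

theorem strictMonoOn_sin_sub_mul_cos :
    StrictMonoOn (fun x => Real.sin x - x * Real.cos x) (Set.Icc 0 Real.pi) := by
  refine strictMonoOn_of_deriv_pos (convex_Icc _ _) (by fun_prop) fun x hx => ?_
  rw [interior_Icc] at hx
  rw [(hasDerivAt_sin_sub_mul_cos x).deriv]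
  exact mul_pos hx.1 (Real.sin_pos_of_pos_of_lt_pi hx.1 hx.2)

theorem strictAntiOn_sin_sub_mul_cos :
    StrictAntiOn (fun x => Real.sin x - x * Real.cos x) (Set.Icc Real.pi (2 * Real.pi)) := by
  refine strictAntiOn_of_deriv_neg (convex_Icc _ _) (by fun_prop) fun x hx => ?_
  rw [interior_Icc] at hx
  rw [(hasDerivAt_sin_sub_mul_cos x).deriv]
  have hsin : 0 < Real.sin (x - Real.pi) :=
    Real.sin_pos_of_pos_of_lt_pi (by linarith [hx.1]) (by linarith [hx.2])
  rw [Real.sin_sub_pi] at hsin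
  nlinarith [Real.pi_pos, hx.1]

/-- Past a positive zero of `sin x - x cos x`, this function is negative up to `2π`. -/
theorem sin_lt_mul_cos_of_root {ρ b : ℝ} (hρpos : 0 < ρ)
    (hρroot : Real.sin ρ - ρ * Real.cos ρ = 0) (hbl : ρ < b) (hbu : b < 2 * Real.pi) :
    Real.sin b < b * Real.cos b := by
  have hπρ : Real.pi ≤ ρ := by
    by_contra! h
    have := strictMonoOn_sin_sub_mul_cos ⟨le_rfl, Real.pi_pos.le⟩ ⟨hρpos.le, h.le⟩ hρpos
    simp only [Real.sin_zero, zero_mul, sub_zero] at this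
    linarith
  have := strictAntiOn_sin_sub_mul_cos ⟨hπρ, (hbl.trans hbu).le⟩
    ⟨hπρ.trans hbl.le, hbu.le⟩ hbl
  simp only at this
  linarith

theorem exists_coeff_of_mem_span {f : ℝ → ℝ}
    (hf : f ∈ Submodule.span ℝ
      ({fun _ => (1 : ℝ), fun x => x, Real.cos, Real.sin} : Set (ℝ → ℝ))) :
    ∃ c₀ c₁ c₂ c₃ : ℝ, f = fun x => c₀ + c₁ * x + c₂ * Real.cos x + c₃ * Real.sin x := by
  simp only [Submodule.mem_span_insert, Submodule.mem_span_singleton] at hf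
  obtain ⟨c₀, _, ⟨c₁, _, ⟨c₂, _, ⟨c₃, rfl⟩, rfl⟩, rfl⟩, rfl⟩ := hf
  refine ⟨c₀, c₁, c₂, c₃, ?_⟩
  ext x
  simp
  ring

theorem hasDerivAt_coeff_comb (c₀ c₁ c₂ c₃ x : ℝ) :
    HasDerivAt (fun x => c₀ + c₁ * x + c₂ * Real.cos x + c₃ * Real.sin x)
      (c₁ + c₃ * Real.cos x - c₂ * Real.sin x) x := by
  refine (((((hasDerivAt_id' x).const_mul c₁).const_add c₀).fun_add
    ((Real.hasDerivAt_cos x).const_mul c₂)).fun_add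
    ((Real.hasDerivAt_sin x).const_mul c₃)).congr_deriv ?_
  ring

theorem deriv_coeff_comb (c₀ c₁ c₂ c₃ : ℝ) :
    deriv (fun x => c₀ + c₁ * x + c₂ * Real.cos x + c₃ * Real.sin x) =
      fun x => c₁ + 0 * x + c₃ * Real.cos x + (-c₂) * Real.sin x := by
  ext x
  rw [(hasDerivAt_coeff_comb c₀ c₁ c₂ c₃ x).deriv]
  ring

/-- An element of the span vanishing to order three at `b` is a multiple of
`(b - x) - sin (b - x)`; this relates its value and its derivative at `0`. -/
theorem value_deriv_at_zero_of_triple_zero {f : ℝ → ℝ} {b : ℝ}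
    (hf : f ∈ Submodule.span ℝ
      ({fun _ => (1 : ℝ), fun x => x, Real.cos, Real.sin} : Set (ℝ → ℝ)))
    (hb : ∀ i < 3, iteratedDeriv i f b = 0) :
    ∃ c : ℝ, f 0 = c * (b - Real.sin b) ∧ deriv f 0 = -c * (1 - Real.cos b) := by
  obtain ⟨c₀, c₁, c₂, c₃, rfl⟩ := exists_coeff_of_mem_span hf
  have h0 := hb 0 (by norm_num)
  have h1 := hb 1 (by norm_num)
  have h2 := hb 2 (by norm_num)
  rw [iteratedDeriv_zero] at h0
  rw [iteratedDeriv_one, deriv_coeff_comb] at h1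
  rw [iteratedDeriv_succ, iteratedDeriv_one, deriv_coeff_comb, deriv_coeff_comb] at h2
  simp only at h0 h1 h2
  have hsc := Real.sin_sq_add_cos_sq b
  have e2 : c₂ = c₁ * Real.sin b := by
    linear_combination (-Real.cos b) * h2 - Real.sin b * h1 - c₂ * hsc
  have e3 : c₃ = -c₁ * Real.cos b := by
    linear_combination (-Real.sin b) * h2 + Real.cos b * h1 - c₃ * hsc
  refine ⟨-c₁, ?_, ?_⟩
  · simp only [mul_zero, add_zero, Real.cos_zero, mul_one, Real.sin_zero]
    linear_combination h0 + h2 + e2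
  · rw [deriv_coeff_comb]
    simp only [mul_zero, add_zero, Real.cos_zero, mul_one, Real.sin_zero]
    linear_combination e3

/-- Value and one-sided derivative at `0` of the image of a fixed function under `bernOp`. -/
theorem bernOp_three_at_zero {b : ℝ} (hb : 0 < b) {U : Submodule ℝ (ℝ → ℝ)} {p : ℕ → ℝ → ℝ}
    (hp : IsBernsteinBasisOf 3 0 b U p) {t α : ℕ → ℝ} {f : ℝ → ℝ} {f' : ℝ}
    (hf : HasDerivAt f f' 0) (hfix : FixesOn 0 b (bernOp 3 p t α) f) :
    f (t 0) * α 0 * p 0 0 = f 0 ∧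
      f (t 0) * α 0 * deriv (p 0) 0 + f (t 1) * α 1 * deriv (p 1) 0 = f' := by
  obtain ⟨-, hsmooth, hzero⟩ := hp
  have z1 : p 1 0 = 0 := by simpa using (hzero 1 (by norm_num)).1 0 (by norm_num)
  have z2 : p 2 0 = 0 := by simpa using (hzero 2 (by norm_num)).1 0 (by norm_num)
  have z3 : p 3 0 = 0 := by simpa using (hzero 3 (by norm_num)).1 0 (by norm_num)
  have d2 : deriv (p 2) 0 = 0 := by
    simpa [iteratedDeriv_one] using (hzero 2 (by norm_num)).1 1 (by norm_num)
  have d3 : deriv (p 3) 0 = 0 := by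
    simpa [iteratedDeriv_one] using (hzero 3 (by norm_num)).1 1 (by norm_num)
  have h0 : (0 : ℝ) ∈ Set.Icc 0 b := ⟨le_rfl, hb.le⟩
  constructor
  · simpa [bernOp, Finset.sum_range_succ, z1, z2, z3] using hfix 0 h0
  · have hB : HasDerivAt (bernOp 3 p t α f)
        (∑ k ∈ Finset.range (3 + 1), f (t k) * α k * deriv (p k) 0) 0 := by
      refine HasDerivAt.fun_sum fun k hk => ?_
      have hdiff : Differentiable ℝ (p k) :=
        (hsmooth k (Nat.lt_succ_iff.mp (Finset.mem_range.mp hk))).differentiable (by norm_num)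
      exact (hdiff 0).hasDerivAt.const_mul _
    have hw := (hf.hasDerivWithinAt (s := Set.Icc 0 b)).congr hfix (hfix 0 h0)
    have := (uniqueDiffOn_Icc hb 0 h0).eq_deriv _ hB.hasDerivWithinAt hw
    simpa [Finset.sum_range_succ, d2, d3] using this

/-- for b strictly between the first positive root ρ₀ of
sin b = b cos b and 2π, there is no Bernstein operator on
span{1, x, cos x, sin x} over [0,b] fixing 1 and x. -/
theorem no_bernstein_operator_beyond_rho
    (ρ b : ℝ)
    (hρpos : 0 < ρ)
    (hρroot : Real.sin ρ - ρ * Real.cos ρ = 0)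
    (hρfirst : ∀ x, 0 < x → x < ρ → Real.sin x - x * Real.cos x ≠ 0)
    (hbl : ρ < b) (hbu : b < 2 * Real.pi)
    (p : ℕ → ℝ → ℝ)
    (hp : IsNonnegBernsteinBasisOf 3 0 b
      (Submodule.span ℝ ({fun _ => (1 : ℝ), fun x => x, Real.cos, Real.sin} : Set (ℝ → ℝ))) p) :
    ¬ ∃ (t : ℕ → ℝ) (α : ℕ → ℝ),
        (∀ k ≤ 3, t k ∈ Set.Icc (0 : ℝ) b) ∧
        (∀ k ≤ 3, 0 < α k) ∧
        FixesOn 0 b (bernOp 3 p t α) (fun _ => (1 : ℝ)) ∧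
        FixesOn 0 b (bernOp 3 p t α) (fun x => x) := by
  rintro ⟨t, α, ht, -, hfix1, hfixx⟩
  have hlt := sin_lt_mul_cos_of_root hρpos hρroot hbl hbu
  have hb : 0 < b := hρpos.trans hbl
  obtain ⟨v1, e1⟩ := bernOp_three_at_zero hb hp.1 (hasDerivAt_const 0 (1 : ℝ)) hfix1
  obtain ⟨vx, ex⟩ := bernOp_three_at_zero hb hp.1 (hasDerivAt_id' (0 : ℝ)) hfixx
  have ht0 : t 0 = 0 := by linear_combination vx - t 0 * v1
  obtain ⟨c, hc0, hc1⟩ := value_deriv_at_zero_of_triple_zero (hp.1.1 0 (by norm_num))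
    ((hp.1.2.2 0 (by norm_num)).2.2.1)
  rw [hc0] at v1
  rw [hc1] at e1 ex
  rw [ht0] at ex
  have hαc : α 0 * c ≠ 0 := by
    intro h
    have : (0 : ℝ) = 1 := by linear_combination v1 - (b - Real.sin b) * h
    norm_num at this
  have hnode : t 1 * (1 - Real.cos b) = b - Real.sin b := by
    apply mul_left_cancel₀ hαc
    linear_combination ex - t 1 * e1 - v1
  have := mul_le_mul_of_nonneg_right (ht 1 (by norm_num)).2
    (sub_nonneg.mpr (Real.cos_le_one b))
  linarith
end
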